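/- arXiv:2407.09213 — 4 statements merged into one kernel-verified Lean document; each statement's English description precedes it below -/
import Mathlib

section
/- Let Λ = Λ(p,e) be a hyperbolicity cone with p complete, diagonalizable and λ(ℝ^n) = ℝ^d_↓. For x ∈ ℝ^n let A ∈ G_p be such that x = A(Δ(λ(x))). Then the projection of x onto Λ in the norm ‖·‖_p is P_Λ(x) = A(Δ(λ(x)_+)), where λ(x)_+ is the componentwise maximum of λ(x) with 0. -/
section HypAux
open Filter Topology

structure HypSys {n d : ℕ} (P : MvPolynomial (Fin n) ℝ) (e : Fin n → ℝ)
    (lm : (Fin n → ℝ) → Fin d → ℝ) : Prop where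
  hhom : P.IsHomogeneous d
  hpe : MvPolynomial.eval e P ≠ 0
  hroots : ∀ (x : Fin n → ℝ) (t : ℝ),
      MvPolynomial.eval (x - t • e) P = MvPolynomial.eval e P * ∏ i, (lm x i - t)
  hord : ∀ x, Antitone (lm x)

theorem antitone_unique {d : ℕ} (a b : Fin d → ℝ) (ha : Antitone a) (hb : Antitone b)
    (h : ∀ t : ℝ, ∏ i, (a i - t) = ∏ i, (b i - t)) : a = b := by
  have h1 : ∏ i, (Polynomial.X - Polynomial.C (a i)) = ∏ i, (Polynomial.X - Polynomial.C (b i)) := by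
    apply Polynomial.funext
    intro t
    have := h t
    simp only [Polynomial.eval_prod, Polynomial.eval_sub, Polynomial.eval_X, Polynomial.eval_C]
    have e1 : ∀ c : Fin d → ℝ, ∏ i, (t - c i) = (∏ i : Fin d, (-1 : ℝ)) * ∏ i, (c i - t) := by
      intro c
      rw [← Finset.prod_mul_distrib]
      exact Finset.prod_congr rfl (fun i _ => by ring)
    rw [e1, e1, this]
  have h2 := congrArg Polynomial.roots h1
  have h4 : ∀ c : Fin d → ℝ, (∏ i, (Polynomial.X - Polynomial.C (c i))).roots
      = Multiset.map c Finset.univ.val := by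
    intro c
    have := Polynomial.roots_multiset_prod_X_sub_C (Multiset.map c Finset.univ.val)
    rw [Multiset.map_map] at this
    exact this
  rw [h4, h4] at h2
  apply List.ofFn_injective
  apply List.Perm.eq_of_sortedGE ha.sortedGE_ofFn hb.sortedGE_ofFn
  have h3 : ∀ c : Fin d → ℝ, Multiset.map c Finset.univ.val = (List.ofFn c : Multiset ℝ) := by
    intro c
    rw [List.ofFn_eq_map]
    rfl
  rw [h3, h3] at h2
  exact Multiset.coe_eq_coe.1 h2

theorem eval_smul_hom {n d : ℕ} {P : MvPolynomial (Fin n) ℝ} (h : P.IsHomogeneous d) (c : ℝ)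
    (x : Fin n → ℝ) : MvPolynomial.eval (c • x) P = c ^ d * MvPolynomial.eval x P := by
  rw [MvPolynomial.eval_eq, MvPolynomial.eval_eq, Finset.mul_sum]
  refine Finset.sum_congr rfl (fun m hm => ?_)
  have hd : ∑ i ∈ m.support, m i = d := by
    have := h (MvPolynomial.mem_support_iff.1 hm)
    rw [← this]
    simp [Finsupp.weight_apply, Finsupp.sum]
  simp only [Pi.smul_apply, smul_eq_mul, mul_pow, Finset.prod_mul_distrib, Finset.prod_pow_eq_pow_sum, hd]
  ring

theorem cont_eval {n : ℕ} (P : MvPolynomial (Fin n) ℝ) :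
    Continuous (fun x : Fin n → ℝ => MvPolynomial.eval x P) := MvPolynomial.continuous_eval P

namespace HypSys
variable {n d : ℕ} {P : MvPolynomial (Fin n) ℝ} {e : Fin n → ℝ} {lm : (Fin n → ℝ) → Fin d → ℝ}

theorem lm_eq (H : HypSys P e lm) {x : Fin n → ℝ} {a : Fin d → ℝ} (ha : Antitone a)
    (h : ∀ t : ℝ, MvPolynomial.eval (x - t • e) P = MvPolynomial.eval e P * ∏ i, (a i - t)) :
    lm x = a := by
  apply antitone_unique _ _ (H.hord x) ha
  intro t
  have := h t
  rw [H.hroots] at this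
  exact mul_left_cancel₀ H.hpe this

theorem lm_add (H : HypSys P e lm) (x : Fin n → ℝ) (c : ℝ) (i) :
    lm (x + c • e) i = lm x i + c := by
  have : lm (x + c • e) = fun i => lm x i + c := by
    apply H.lm_eq
    · intro i j hij
      simpa using H.hord x hij
    · intro t
      have := H.hroots x (t - c)
      rw [show x + c • e - t • e = x - (t - c) • e by module, this]
      congr 1
      exact Finset.prod_congr rfl (fun i _ => by ring)
  rw [this]

theorem lm_smul (H : HypSys P e lm) (x : Fin n → ℝ) {c : ℝ} (hc : 0 < c) (i) :
    lm (c • x) i = c * lm x i := by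
  have : lm (c • x) = fun i => c * lm x i := by
    apply H.lm_eq
    · intro i j hij
      exact mul_le_mul_of_nonneg_left (H.hord x hij) hc.le
    · intro t
      have := H.hroots x (t / c)
      rw [show c • x - t • e = c • (x - (t / c) • e) by
        rw [smul_sub, smul_smul]; congr 2; field_simp, eval_smul_hom H.hhom, this]
      have : c ^ d * ∏ i, (lm x i - t / c) = ∏ i, (c * lm x i - t) := by
        have e1 : c ^ d = ∏ i : Fin d, c := by simp
        rw [e1, ← Finset.prod_mul_distrib]
        exact Finset.prod_congr rfl (fun i _ => by field_simp)
      rw [← this]; ring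
  rw [this]

theorem eval_lm (H : HypSys P e lm) (x : Fin n → ℝ) (i) :
    MvPolynomial.eval (x - lm x i • e) P = 0 := by
  rw [H.hroots, Finset.prod_eq_zero (Finset.mem_univ i) (by simp), mul_zero]

theorem exists_of_eval (H : HypSys P e lm) {x : Fin n → ℝ} {t : ℝ}
    (h : MvPolynomial.eval (x - t • e) P = 0) : ∃ i, lm x i = t := by
  rw [H.hroots] at h
  obtain ⟨i, -, hi⟩ := Finset.prod_eq_zero_iff.1 ((mul_eq_zero.1 h).resolve_left H.hpe)
  exact ⟨i, by linarith⟩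

theorem lm_neg_neg (H : HypSys P e lm) {z : Fin n → ℝ} (hz : ∀ i, 0 < lm z i) (i) :
    lm (-z) i < 0 := by
  have h := H.eval_lm (-z) i
  rw [show -z - lm (-z) i • e = (-1 : ℝ) • (z - (-lm (-z) i) • e) by module,
    eval_smul_hom H.hhom] at h
  obtain ⟨j, hj⟩ := H.exists_of_eval ((mul_eq_zero.1 h).resolve_left (by simp))
  have := hz j
  linarith

theorem bound (H : HypSys P e lm) : ∃ C : ℝ, ∀ x i, |lm x i| ≤ C * ‖x‖ := by
  have hne : MvPolynomial.eval ((0 : Fin n → ℝ) - e) P ≠ 0 := by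
    rw [show (0 : Fin n → ℝ) - e = (-1 : ℝ) • e by module, eval_smul_hom H.hhom]
    exact mul_ne_zero (by simp) H.hpe
  have hc : Continuous (fun y : Fin n → ℝ => MvPolynomial.eval (y - e) P) :=
    (cont_eval P).comp (continuous_id.sub continuous_const)
  have hev := hc.continuousAt.eventually_ne hne
  obtain ⟨δ, hδ, hb⟩ := Metric.eventually_nhds_iff.1 hev
  refine ⟨δ⁻¹, fun x i => ?_⟩
  by_cases ht : lm x i = 0
  · rw [ht]; simp only [abs_zero]; positivity
  have h := H.eval_lm x i
  rw [show x - lm x i • e = (lm x i) • ((lm x i)⁻¹ • x - e) by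
    rw [smul_sub, smul_smul, mul_inv_cancel₀ ht, one_smul], eval_smul_hom H.hhom] at h
  have h' := (mul_eq_zero.1 h).resolve_left (pow_ne_zero _ ht)
  by_contra hcon
  push Not at hcon
  refine hb (y := (lm x i)⁻¹ • x) ?_ h'
  rw [dist_zero_right, norm_smul, norm_inv, Real.norm_eq_abs]
  have hp : 0 < |lm x i| := abs_pos.2 ht
  rw [inv_mul_lt_iff₀ hδ] at hcon
  rw [inv_mul_lt_iff₀ hp]
  linarith

theorem cont (H : HypSys P e lm) : Continuous lm := by
  obtain ⟨C, hC⟩ := H.bound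
  rw [continuous_iff_continuousAt]
  intro x0
  set R := |C| * (‖x0‖ + 1) with hR
  have hcomp : IsCompact (Set.univ.pi fun _ : Fin d => Set.Icc (-R) R) :=
    isCompact_univ_pi fun _ => isCompact_Icc
  refine hcomp.tendsto_nhds_of_unique_mapClusterPt ?_ ?_
  · filter_upwards [Metric.ball_mem_nhds x0 one_pos] with x hx i _
    have h1 : ‖x‖ ≤ ‖x0‖ + 1 := by
      have := norm_le_norm_add_norm_sub' x x0
      rw [Metric.mem_ball, dist_eq_norm] at hx
      linarith
    have h2 : |lm x i| ≤ R := (hC x i).trans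
      (mul_le_mul (le_abs_self C) h1 (norm_nonneg _) (abs_nonneg _))
    exact abs_le.1 h2
  · intro a _ ha
    let K : Set ((Fin n → ℝ) × (Fin d → ℝ)) := {q | Antitone q.2 ∧ ∀ t : ℝ,
      MvPolynomial.eval (q.1 - t • e) P = MvPolynomial.eval e P * ∏ i, (q.2 i - t)}
    have hK : IsClosed K := by
      have : K = (⋂ (i : Fin d) (j : Fin d) (_ : i ≤ j), {q | q.2 j ≤ q.2 i}) ∩ ⋂ t : ℝ, {q |
        MvPolynomial.eval (q.1 - t • e) P = MvPolynomial.eval e P * ∏ i, (q.2 i - t)} := by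
        ext q
        simp [K, Antitone]
      rw [this]
      refine IsClosed.inter ?_ ?_
      · refine isClosed_iInter fun i => isClosed_iInter fun j => isClosed_iInter fun _ => ?_
        exact isClosed_le (by fun_prop) (by fun_prop)
      · refine isClosed_iInter fun t => isClosed_eq ?_ (by fun_prop)
        exact (cont_eval P).comp (by fun_prop)
    have hmem : (x0, a) ∈ K := by
      rw [← hK.closure_eq, mem_closure_iff_nhds_basis ((𝓝 x0).basis_sets.prod_nhds (𝓝 a).basis_sets)]
      rintro ⟨U, V⟩ ⟨hU, hV⟩
      have := (mapClusterPt_iff_frequently.1 ha V hV).and_eventually hU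
      obtain ⟨x, hx1, hx2⟩ := this.exists
      exact ⟨(x, lm x), ⟨H.hord x, H.hroots x⟩, hx2, hx1⟩
    exact (H.lm_eq hmem.1 hmem.2).symm

theorem ev_pos (H : HypSys P e lm) (x w : Fin n → ℝ) (i) (h : 0 < lm w i) :
    ∀ᶠ s : ℝ in atTop, 0 < lm (x + s • w) i := by
  have hc : Continuous (fun c : ℝ => lm (w + c • x) i) :=
    (continuous_apply i).comp (H.cont.comp (by fun_prop))
  have h1 : ∀ᶠ c : ℝ in 𝓝 0, 0 < lm (w + c • x) i :=
    hc.continuousAt.eventually_const_lt (by simpa using h)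
  filter_upwards [tendsto_inv_atTop_zero.eventually h1, eventually_gt_atTop 0] with s hs hs0
  rw [show x + s • w = s • (w + s⁻¹ • x) by
    rw [smul_add, smul_smul, mul_inv_cancel₀ hs0.ne', one_smul, add_comm], H.lm_smul _ hs0]
  positivity

theorem ev_neg (H : HypSys P e lm) (x w : Fin n → ℝ) (i) (h : lm w i < 0) :
    ∀ᶠ s : ℝ in atTop, lm (x + s • w) i < 0 := by
  have hc : Continuous (fun c : ℝ => lm (w + c • x) i) :=
    (continuous_apply i).comp (H.cont.comp (by fun_prop))
  have h1 : ∀ᶠ c : ℝ in 𝓝 0, lm (w + c • x) i < 0 :=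
    hc.continuousAt.eventually_lt_const (by simpa using h)
  filter_upwards [tendsto_inv_atTop_zero.eventually h1, eventually_gt_atTop 0] with s hs hs0
  rw [show x + s • w = s • (w + s⁻¹ • x) by
    rw [smul_add, smul_smul, mul_inv_cancel₀ hs0.ne', one_smul, add_comm], H.lm_smul _ hs0]
  exact mul_neg_of_pos_of_neg hs0 hs

theorem hom_aeval {n : ℕ} {S : Type*} [CommRing S] [Algebra ℝ S] (ψ : S →+* ℝ) (f : Fin n → S)
    (P : MvPolynomial (Fin n) ℝ) :
    ψ (MvPolynomial.aeval f P) = MvPolynomial.eval (fun j => ψ (f j)) P := by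
  rw [MvPolynomial.aeval_def, MvPolynomial.hom_eval₂,
    Subsingleton.elim (ψ.comp (algebraMap ℝ S)) (RingHom.id ℝ)]
  rfl

open Polynomial in
theorem exists_line (P : MvPolynomial (Fin n) ℝ) (hP : P.IsHomogeneous d) (x z : Fin n → ℝ) :
    ∃ q : ℝ[X], q.natDegree ≤ d ∧ ∀ s, q.eval s = MvPolynomial.eval (x + s • z) P := by
  refine ⟨MvPolynomial.aeval (fun j => C (x j) + X * C (z j)) P, ?_, fun s => ?_⟩
  · have := MvPolynomial.aeval_natDegree_le (m := d) (n := 1) P hP.totalDegree_le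
      (fun j => C (x j) + X * C (z j)) (fun j => by compute_degree)
    simpa using this
  · have := hom_aeval (evalRingHom s) (fun j => C (x j) + X * C (z j)) P
    simp only [coe_evalRingHom] at this
    rw [this]
    congr 1
    congr 1
    ext j
    simp
    ring

open Polynomial in
theorem exists_esymm (H : HypSys P e lm) (x z : Fin n → ℝ) (k : ℕ) (hk : k ≤ d) :
    ∃ q : ℝ[X], ∀ s, q.eval s = MvPolynomial.aeval (lm (x + s • z)) (MvPolynomial.esymm (Fin d) ℝ k) := by
  let f : Fin n → ℝ[X][X] := fun j => C (C (x j) + X * C (z j)) + X * C (C (e j))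
  refine ⟨C (MvPolynomial.eval e P)⁻¹ * (MvPolynomial.aeval f P).coeff (d - k), fun s => ?_⟩
  have h1 : (MvPolynomial.aeval f P).map (evalRingHom s)
      = C (MvPolynomial.eval e P) * ∏ i, (X + C (lm (x + s • z) i)) := by
    apply Polynomial.funext
    intro T
    have h2 := hom_aeval ((evalRingHom T).comp (mapRingHom (evalRingHom s))) f P
    simp only [RingHom.comp_apply, coe_evalRingHom, coe_mapRingHom] at h2
    rw [h2]
    have h3 := H.hroots (x + s • z) (-T)
    have h4 : (fun j => eval T (map (evalRingHom s) (f j))) = x + s • z - (-T) • e := by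
      ext j
      simp [f]
      ring
    rw [h4, h3]
    simp only [eval_mul, eval_C, eval_prod, eval_add, eval_X]
    congr 1
    exact Finset.prod_congr rfl (fun i _ => by ring)
  have h5 := congrArg (fun r => Polynomial.coeff r (d - k)) h1
  simp only [coeff_map, coeff_C_mul, coe_evalRingHom] at h5
  rw [eval_mul, eval_C, h5, ← mul_assoc, inv_mul_cancel₀ H.hpe, one_mul,
    Finset.prod_X_add_C_coeff _ _ (by simp)]
  simp only [Finset.card_univ, Fintype.card_fin, Nat.sub_sub_self hk, MvPolynomial.esymm, map_sum,
    map_prod, MvPolynomial.aeval_X]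

open Polynomial in
theorem exists_symm (H : HypSys P e lm) (x z : Fin n → ℝ) (S : MvPolynomial (Fin d) ℝ)
    (hS : S.IsSymmetric) :
    ∃ q : ℝ[X], ∀ s, q.eval s = MvPolynomial.aeval (lm (x + s • z)) S := by
  obtain ⟨R, hR⟩ := MvPolynomial.esymmAlgHom_surjective (σ := Fin d) ℝ (n := d) (by simp) ⟨S, hS⟩
  choose g hg using fun i : Fin d => H.exists_esymm x z (i + 1) i.2
  refine ⟨MvPolynomial.aeval g R, fun s => ?_⟩
  have h1 := hom_aeval (evalRingHom s) g R
  simp only [coe_evalRingHom] at h1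
  rw [h1]
  have h2 : S = MvPolynomial.aeval (fun i : Fin d => MvPolynomial.esymm (Fin d) ℝ (i + 1)) R := by
    rw [← MvPolynomial.esymmAlgHom_apply, hR]
  rw [h2]
  have h3 := hom_aeval (MvPolynomial.aeval (lm (x + s • z)) : MvPolynomial (Fin d) ℝ →ₐ[ℝ] ℝ).toRingHom
    (fun i : Fin d => MvPolynomial.esymm (Fin d) ℝ (i + 1)) R
  simp only [AlgHom.toRingHom_eq_coe, RingHom.coe_coe] at h3
  rw [h3]
  congr 1
  congr 1
  ext i
  exact hg i s

open Polynomial in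
theorem exists_sum (H : HypSys P e lm) (x z : Fin n → ℝ) (g : ℝ[X]) :
    ∃ q : ℝ[X], ∀ s, q.eval s = ∑ i, g.eval (lm (x + s • z) i) := by
  choose p hp using fun k : ℕ => H.exists_symm x z _ (MvPolynomial.psum_isSymmetric (Fin d) ℝ k)
  refine ⟨∑ k ∈ Finset.range (g.natDegree + 1), C (g.coeff k) * p k, fun s => ?_⟩
  simp only [eval_finsetSum, eval_mul, eval_C, hp, eval_eq_sum_range (p := g)]
  rw [Finset.sum_comm]
  refine Finset.sum_congr rfl fun k _ => ?_
  rw [← Finset.mul_sum]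
  simp [MvPolynomial.psum]

open Polynomial in
theorem sq_bigO (G : ℝ[X]) (h0 : G.eval 0 = 0) (hpos : ∀ s, 0 ≤ G.eval s) :
    (fun s => G.eval s) =O[𝓝 0] (fun s : ℝ => s ^ 2) := by
  have hd : G.derivative.eval 0 = 0 := by
    refine IsLocalMin.hasDerivAt_eq_zero (f := fun s => G.eval s) (a := 0) ?_ (G.hasDerivAt 0)
    exact Filter.Eventually.of_forall fun s => by simpa [h0] using hpos s
  obtain ⟨G1, rfl⟩ : X ∣ G := by
    rw [X_dvd_iff, coeff_zero_eq_eval_zero, h0]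
  obtain ⟨G2, rfl⟩ : X ∣ G1 := by
    rw [X_dvd_iff, coeff_zero_eq_eval_zero]
    simpa using hd
  have hb : (fun s => G2.eval s) =O[𝓝 0] (fun _ : ℝ => (1 : ℝ)) :=
    (G2.continuous.continuousAt (x := (0:ℝ))).tendsto.isBigO_one ℝ
  have := (Asymptotics.isBigO_refl (fun s : ℝ => s ^ 2) (𝓝 0)).mul hb
  refine this.congr (fun s => ?_) (fun s => by ring)
  simp only [eval_mul, eval_X]; ring

open Polynomial in
theorem lip (H : HypSys P e lm) (x z : Fin n → ℝ) (i) (hi : lm x i = 0) :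
    (fun s : ℝ => lm (x + s • z) i) =O[𝓝 0] (fun s : ℝ => s) := by
  classical
  let h : ℝ[X] := ∏ j ∈ Finset.univ.filter (fun j => lm x j ≠ 0), (X - C (lm x j))
  obtain ⟨G, hG⟩ := H.exists_sum x z ((X * h) ^ 2)
  have hG0 : G.eval 0 = 0 := by
    rw [hG]
    refine Finset.sum_eq_zero fun j _ => ?_
    simp only [zero_smul, add_zero, eval_pow, eval_mul, eval_X]
    by_cases hj : lm x j = 0
    · simp [hj]
    · have : h.eval (lm x j) = 0 := by
        rw [eval_prod]
        exact Finset.prod_eq_zero (i := j) (by simpa using hj) (by simp)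
      simp [this]
  have hO := sq_bigO G hG0 (fun s => by
    rw [hG]; exact Finset.sum_nonneg fun j _ => by rw [eval_pow]; positivity)
  have hc : Continuous (fun s : ℝ => lm (x + s • z) i) :=
    (continuous_apply i).comp (H.cont.comp (by fun_prop))
  have hh0 : h.eval 0 ≠ 0 := by
    rw [eval_prod, Finset.prod_ne_zero_iff]
    intro j hj
    simpa using hj
  have hne : h.eval (lm (x + (0:ℝ) • z) i) ≠ 0 := by simpa [hi] using hh0
  have hch : ContinuousAt (fun s : ℝ => (h.eval (lm (x + s • z) i))⁻¹) 0 :=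
    ContinuousAt.inv₀ (h.continuous.comp hc).continuousAt hne
  have hb1 : (fun s : ℝ => lm (x + s • z) i * h.eval (lm (x + s • z) i)) =O[𝓝 0] (fun s : ℝ => s) := by
    have : (fun s : ℝ => (lm (x + s • z) i * h.eval (lm (x + s • z) i)) ^ 2) =O[𝓝 0] (fun s : ℝ => s ^ 2) := by
      refine Asymptotics.IsBigO.trans (Asymptotics.IsBigO.of_bound 1 (Eventually.of_forall fun s => ?_)) hO
      rw [one_mul, Real.norm_of_nonneg (sq_nonneg _), hG, Real.norm_of_nonneg]
      · have := Finset.single_le_sum (f := fun j => ((X * h) ^ 2).eval (lm (x + s • z) j))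
          (fun j _ => by simp only [eval_pow]; positivity) (Finset.mem_univ i)
        simpa using this
      · exact Finset.sum_nonneg fun j _ => by rw [eval_pow]; positivity
    exact this.of_pow two_ne_zero
  have hb2 := hb1.mul (hch.tendsto.isBigO_one ℝ)
  have hev : ∀ᶠ s : ℝ in 𝓝 0, h.eval (lm (x + s • z) i) ≠ 0 :=
    (h.continuous.comp hc).continuousAt.eventually_ne hne
  refine hb2.congr' ?_ (Eventually.of_forall fun s => by simp)
  filter_upwards [hev] with s hs
  field_simp

open Polynomial in
theorem mult_le (q : ℝ[X]) (hq : q ≠ 0) (a : ℝ) (m : ℕ)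
    (h : (fun s => q.eval (a + s)) =O[𝓝 0] (fun s : ℝ => s ^ m)) : m ≤ q.rootMultiplicity a := by
  by_contra hlt
  push Not at hlt
  obtain ⟨r, hr, hnd⟩ := exists_eq_pow_rootMultiplicity_mul_and_not_dvd q hq a
  set k := q.rootMultiplicity a
  have hra : r.eval a ≠ 0 := by
    rwa [dvd_iff_isRoot] at hnd
  obtain ⟨c, hc⟩ := h.bound
  have hev : ∀ᶠ s : ℝ in 𝓝[≠] 0, |r.eval (a + s)| ≤ c * |s| ^ (m - k) := by
    filter_upwards [hc.filter_mono nhdsWithin_le_nhds, self_mem_nhdsWithin] with s hs hs0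
    have hs0 : s ≠ 0 := hs0
    rw [hr] at hs
    simp only [eval_mul, eval_pow, eval_sub, eval_X, eval_C, add_sub_cancel_left, norm_mul, norm_pow,
      Real.norm_eq_abs] at hs
    have hp : 0 < |s| ^ k := by positivity
    refine le_of_mul_le_mul_left ?_ hp
    calc _ ≤ _ := hs
      _ = _ := by
        rw [show m = k + (m - k) by omega, pow_add]
        simp only [Nat.add_sub_cancel_left]; ring
  have t1 : Tendsto (fun s : ℝ => |r.eval (a + s)|) (𝓝[≠] 0) (𝓝 |r.eval (a + 0)|) := by
    have : Continuous (fun s : ℝ => |r.eval (a + s)|) := by fun_prop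
    exact this.continuousAt.tendsto.mono_left nhdsWithin_le_nhds
  have t2 : Tendsto (fun s : ℝ => c * |s| ^ (m - k)) (𝓝[≠] 0) (𝓝 (c * |(0:ℝ)| ^ (m - k))) := by
    have : Continuous (fun s : ℝ => c * |s| ^ (m - k)) := by fun_prop
    exact this.continuousAt.tendsto.mono_left nhdsWithin_le_nhds
  have := le_of_tendsto_of_tendsto t1 t2 hev
  rw [abs_zero, zero_pow (by omega), mul_zero, add_zero] at this
  exact hra (abs_eq_zero.1 (le_antisymm this (abs_nonneg _)))

open Polynomial in
theorem mult_line (H : HypSys P e lm) (x z : Fin n → ℝ) (q : ℝ[X]) (hq0 : q ≠ 0)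
    (hq : ∀ s, q.eval s = MvPolynomial.eval (x + s • z) P) (a : ℝ) :
    (Finset.univ.filter (fun i => lm (x + a • z) i = 0)).card ≤ q.rootMultiplicity a := by
  classical
  apply mult_le q hq0
  have h1 : ∀ s, q.eval (a + s) = MvPolynomial.eval e P * ∏ i, lm ((x + a • z) + s • z) i := by
    intro s
    have := H.hroots (x + (a + s) • z) 0
    rw [zero_smul, sub_zero] at this
    rw [hq, this, show x + (a + s) • z = x + a • z + s • z by module]
    simp
  have h2 : ∀ i ∈ (Finset.univ : Finset (Fin d)), (fun s : ℝ => lm ((x + a • z) + s • z) i) =O[𝓝 0]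
      (fun s : ℝ => if lm (x + a • z) i = 0 then s else 1) := by
    intro i _
    by_cases hi : lm (x + a • z) i = 0
    · simpa [hi] using H.lip (x + a • z) z i hi
    · simp only [hi, if_false]
      have hc : Continuous (fun s : ℝ => lm ((x + a • z) + s • z) i) :=
        (continuous_apply i).comp (H.cont.comp (by fun_prop))
      exact hc.continuousAt.tendsto.isBigO_one ℝ
  have h3 := (Asymptotics.IsBigO.finsetProd h2).const_mul_left (MvPolynomial.eval e P)
  refine h3.congr (fun s => (h1 s).symm) (fun s => ?_)
  rw [Finset.prod_ite]
  simp

open Polynomial in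
theorem mono_pos (H : HypSys P e lm) (x z : Fin n → ℝ) (hz : ∀ i, 0 < lm z i) (i) :
    lm x i ≤ lm (x + z) i := by
  classical
  by_contra hlt
  push Not at hlt
  set y := x + (-lm x i) • e with hy
  have hyl : ∀ (s : ℝ) j, lm (y + s • z) j = lm (x + s • z) j - lm x i := by
    intro s j
    rw [show y + s • z = (x + s • z) + (-lm x i) • e by rw [hy]; module, H.lm_add]; ring
  have hy0 : lm (y + (0:ℝ) • z) i = 0 := by rw [hyl]; simp
  have hy1 : lm (y + (1:ℝ) • z) i < 0 := by rw [hyl, one_smul]; linarith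
  have hc : ∀ j, Continuous (fun s : ℝ => lm (y + s • z) j) := fun j =>
    (continuous_apply j).comp (H.cont.comp (by fun_prop))
  have hp : ∀ᶠ s : ℝ in atTop, ∀ j, 0 < lm (y + s • z) j :=
    eventually_all.2 fun j => H.ev_pos y z j (hz j)
  have hn : ∀ᶠ s : ℝ in atTop, ∀ j, lm (y + s • (-z)) j < 0 :=
    eventually_all.2 fun j => H.ev_neg y (-z) j (H.lm_neg_neg hz j)
  obtain ⟨S, hS, hSp⟩ := (hp.and (eventually_ge_atTop (1:ℝ))).exists
  obtain ⟨S', hS', hSp'⟩ := (hn.and (eventually_ge_atTop (1:ℝ))).exists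
  have hzero : ∀ j, ∃ s : ℝ, lm (y + s • z) j = 0 := by
    intro j
    have h1 : lm (y + (-S') • z) j ≤ 0 := by
      have := hS' j
      rw [smul_neg, ← neg_smul] at this
      exact this.le
    obtain ⟨s, -, hs⟩ := intermediate_value_Icc (by linarith : -S' ≤ S) (hc j).continuousOn
      (⟨h1, (hS j).le⟩ : (0:ℝ) ∈ Set.Icc _ _)
    exact ⟨s, hs⟩
  obtain ⟨s1, hs1m, hs1⟩ := intermediate_value_Icc hSp (hc i).continuousOn
      (⟨hy1.le, (hS i).le⟩ : (0:ℝ) ∈ Set.Icc _ _)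
  have hs1m : 1 ≤ s1 := hs1m.1
  have hs1 : lm (y + s1 • z) i = 0 := hs1
  choose σ hσ using hzero
  obtain ⟨s2, hs2, hs2n⟩ : ∃ s2, lm (y + s2 • z) i = 0 ∧ s2 ≠ σ i := by
    by_cases h : σ i = 0
    · exact ⟨s1, hs1, by rw [h]; linarith⟩
    · exact ⟨0, hy0, Ne.symm h⟩
  obtain ⟨q, hqd, hq⟩ := exists_line P H.hhom y z
  have hqe : ∀ s, q.eval s = MvPolynomial.eval e P * ∏ j, lm (y + s • z) j := by
    intro s
    have := H.hroots (y + s • z) 0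
    rw [zero_smul, sub_zero] at this
    rw [hq, this]; simp
  have hq0 : q ≠ 0 := by
    rintro rfl
    have := hqe S
    rw [eval_zero] at this
    exact mul_ne_zero H.hpe (Finset.prod_ne_zero_iff.2 fun j _ => (hS j).ne') this.symm
  let T : Finset (Fin d × ℝ) := insert (i, s2) (Finset.univ.image fun j => (j, σ j))
  have hT0 : ∀ p ∈ T, lm (y + p.2 • z) p.1 = 0 := by
    intro p hp
    simp only [T, Finset.mem_insert, Finset.mem_image, Finset.mem_univ, true_and] at hp
    rcases hp with rfl | ⟨j, rfl⟩
    · exact hs2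
    · exact hσ j
  have hTc : T.card = d + 1 := by
    rw [Finset.card_insert_of_notMem, Finset.card_image_of_injective]
    · simp
    · intro a b hab
      exact (Prod.mk.inj hab).1
    · simp only [Finset.mem_image, Finset.mem_univ, true_and, not_exists]
      intro j hj
      obtain ⟨h1, h2⟩ := Prod.mk.inj hj
      subst h1
      exact hs2n h2.symm
  have hmaps : Set.MapsTo Prod.snd (T : Set (Fin d × ℝ)) (q.roots.toFinset : Set ℝ) := by
    intro p hp
    simp only [Finset.mem_coe, Multiset.mem_toFinset]
    rw [mem_roots hq0, IsRoot.def, hqe, Finset.prod_eq_zero (Finset.mem_univ p.1) (hT0 p hp), mul_zero]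
  have hcard := Finset.card_eq_sum_card_fiberwise hmaps
  have hle : ∑ b ∈ q.roots.toFinset, (T.filter fun p => p.2 = b).card
      ≤ ∑ b ∈ q.roots.toFinset, q.roots.count b := by
    refine Finset.sum_le_sum fun b _ => ?_
    rw [count_roots]
    refine le_trans ?_ (H.mult_line y z q hq0 hq b)
    refine Finset.card_le_card_of_injOn Prod.fst ?_ ?_
    · intro p hp
      simp only [Finset.coe_filter, Set.mem_ofPred_eq] at hp
      simp only [Finset.coe_filter, Set.mem_ofPred_eq, Finset.mem_univ, true_and]
      rw [← hp.2]
      exact hT0 p hp.1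
    · intro p hp p' hp' h
      simp only [Finset.coe_filter, Set.mem_ofPred_eq] at hp hp'
      exact Prod.ext h (hp.2.trans hp'.2.symm)
  rw [Multiset.toFinset_sum_count_eq] at hle
  have := q.card_roots'
  omega

theorem mono (H : HypSys P e lm) (x z : Fin n → ℝ) (hz : ∀ i, 0 ≤ lm z i) (i) :
    lm x i ≤ lm (x + z) i := by
  refine le_of_forall_pos_le_add fun ε hε => ?_
  have := H.mono_pos x (z + ε • e) (fun j => by rw [H.lm_add]; linarith [hz j]) i
  rwa [← add_assoc, H.lm_add] at this

end HypSys

end HypAux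


/-- Let `Λ = Λ(p,e)` with `p` complete, diagonalizable (with
isometry `Δ` and orthogonal eigenvalue-preserving maps `A ∈ G_p`) and
`λ(ℝ^n) = ℝ^d↓`. If `x = A(Δ(λ(x)))` with `A ∈ G_p`, then the projection of `x`
onto `Λ` in the norm `‖·‖_p` is `A(Δ(λ(x)₊))`. -/
theorem stmt_7 {n d : ℕ}
    (P : MvPolynomial (Fin n) ℝ) (e : Fin n → ℝ)
    (lm : (Fin n → ℝ) → Fin d → ℝ)
    (hhom : P.IsHomogeneous d)
    (hpe : MvPolynomial.eval e P ≠ 0)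
    (hroots : ∀ (x : Fin n → ℝ) (t : ℝ),
      MvPolynomial.eval (x - t • e) P = MvPolynomial.eval e P * ∏ i, (lm x i - t))
    (hord : ∀ x, Antitone (lm x))
    (hcomplete : ∀ x, lm x = 0 → x = 0)
    (hrange : Set.range lm = {u : Fin d → ℝ | Antitone u})
    (Δ : (Fin d → ℝ) →ₗ[ℝ] (Fin n → ℝ))
    (hΔiso : ∀ u : Fin d → ℝ,
      Real.sqrt (∑ i, lm (Δ u) i ^ 2) = Real.sqrt (∑ i, u i ^ 2))
    (hdiag : ∀ x : Fin n → ℝ, ∃ A : (Fin n → ℝ) →ₗ[ℝ] (Fin n → ℝ),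
      Function.Bijective A ∧ (∀ z, lm (A z) = lm z) ∧ x = A (Δ (lm x)))
    (x : Fin n → ℝ) (A : (Fin n → ℝ) →ₗ[ℝ] (Fin n → ℝ))
    (hAbij : Function.Bijective A) (hAlm : ∀ z, lm (A z) = lm z)
    (hxA : x = A (Δ (lm x))) :
    (∀ i, 0 ≤ lm (A (Δ fun i => max (lm x i) 0)) i) ∧
    ∀ z : Fin n → ℝ, (∀ i, 0 ≤ lm z i) →
      Real.sqrt (∑ i, lm (x - A (Δ fun i => max (lm x i) 0)) i ^ 2)
        ≤ Real.sqrt (∑ i, lm (x - z) i ^ 2) := by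
  have H : HypSys P e lm := ⟨hhom, hpe, hroots, hord⟩
  have hlmΔ : ∀ u : Fin d → ℝ, Antitone u → lm (Δ u) = u := by
    intro u hu
    have : u ∈ Set.range lm := by rw [hrange]; exact hu
    obtain ⟨w, rfl⟩ := this
    obtain ⟨B, -, hB, hw⟩ := hdiag w
    have := hB (Δ (lm w))
    rw [← hw] at this
    exact this.symm
  have hanti : Antitone (fun i => max (lm x i) 0) := fun i j hij =>
    max_le_max (hord x hij) le_rfl
  refine ⟨fun i => ?_, fun z hz => ?_⟩
  · rw [hAlm, hlmΔ _ hanti]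
    exact le_max_right _ _
  · have h1 : x - A (Δ fun i => max (lm x i) 0) = A (Δ (lm x - fun i => max (lm x i) 0)) := by
      rw [map_sub, map_sub, ← hxA]
    rw [h1, hAlm, hΔiso]
    apply Real.sqrt_le_sqrt
    refine Finset.sum_le_sum fun i _ => ?_
    have h2 := H.mono (x - z) z hz i
    rw [sub_add_cancel] at h2
    simp only [Pi.sub_apply]
    rcases le_total (lm x i) 0 with h | h
    · rw [max_eq_right h]
      nlinarith
    · rw [max_eq_left h]
      nlinarith [sq_nonneg (lm (x - z) i)]
end

section
/- Let f : ℝ^n → ℝ be a (finite-valued, hence closed proper) μ-strongly convex function with μ > 0, T : ℝ^n → ℝ^m a linear map, b ∈ ℝ^m, and K ⊆ ℝ^m a regular closed convex cone. Let p* be the optimal value of the primal problem min{f(x) : Tx + b ∈ K} and d* the optimal value of the dual problem min{f*(T*y) + ⟨b,y⟩ : y ∈ K*}. Then: (i) p* + d* = 0; (ii) if the primal problem is feasible, then p* and d* are finite and p* is attained; (iii) if the primal satisfies Slater's condition (there exists x̄ with T x̄ + b ∈ int K), then p* and d* are both finite and attained. -/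
open scoped RealInnerProductSpace

/-- The Fenchel conjugate `f*(s) = sup_x (⟨s,x⟩ - f(x))` of a function on `ℝ^n`
(a real-valued supremum; it is finite when `f` is strongly convex). -/
noncomputable def fenchelConj {n : ℕ} (f : EuclideanSpace ℝ (Fin n) → ℝ)
    (s : EuclideanSpace ℝ (Fin n)) : ℝ :=
  ⨆ x, (⟪s, x⟫ - f x)

section aux

open Filter Topology

variable {E F : Type*} [NormedAddCommGroup E] [InnerProductSpace ℝ E] [FiniteDimensional ℝ E]
  [NormedAddCommGroup F] [InnerProductSpace ℝ F] [FiniteDimensional ℝ F]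

theorem aux_exists_min {X : Type*} [NormedAddCommGroup X] [ProperSpace X] (g : X → ℝ)
    (hg : Continuous g) (S : Set X) (hS : IsClosed S) (x0 : X) (hx0 : x0 ∈ S) (R : ℝ)
    (hR : ∀ x ∈ S, g x ≤ g x0 → ‖x‖ ≤ R) : ∃ x ∈ S, ∀ y ∈ S, g x ≤ g y := by
  have hc : IsCompact (S ∩ {x | g x ≤ g x0}) := by
    apply Metric.isCompact_of_isClosed_isBounded
    · exact hS.inter (isClosed_le hg continuous_const)
    · refine (Metric.isBounded_closedBall (x := (0 : X)) (r := R)).subset ?_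
      rintro x ⟨h1, h2⟩
      simpa using hR x h1 h2
  obtain ⟨x, hx, hmin⟩ := hc.exists_isMinOn ⟨x0, hx0, le_refl (g x0)⟩ hg.continuousOn
  refine ⟨x, hx.1, fun y hy => ?_⟩
  by_cases h : g y ≤ g x0
  · exact hmin ⟨hy, h⟩
  · exact le_trans hx.2 (le_of_lt (not_le.mp h))

theorem aux_cont (μ : ℝ) (hμ : 0 < μ) (f : E → ℝ)
    (hf : ∀ x y : E, ∀ θ : ℝ, 0 ≤ θ → θ ≤ 1 →
      f (θ • x + (1 - θ) • y)
        ≤ θ * f x + (1 - θ) * f y - μ / 2 * θ * (1 - θ) * ‖x - y‖ ^ 2) :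
    Continuous f := by
  have h : ConvexOn ℝ Set.univ f := by
    refine ⟨convex_univ, ?_⟩
    intro x _ y _ a c ha hc hac
    obtain rfl : c = 1 - a := by linarith
    have := hf x y a ha (by linarith)
    have h2 : 0 ≤ μ / 2 * a * (1 - a) * ‖x - y‖ ^ 2 := by positivity
    simp only [smul_eq_mul]
    linarith
  exact continuousOn_univ.mp (h.continuousOn isOpen_univ)

theorem aux_growth (μ : ℝ) (hμ : 0 < μ) (f : E → ℝ)
    (hf : ∀ x y : E, ∀ θ : ℝ, 0 ≤ θ → θ ≤ 1 →
      f (θ • x + (1 - θ) • y)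
        ≤ θ * f x + (1 - θ) * f y - μ / 2 * θ * (1 - θ) * ‖x - y‖ ^ 2) :
    ∃ A : ℝ, ∀ x, μ / 4 * ‖x‖ ^ 2 - A ≤ f x := by
  have hcont := aux_cont μ hμ f hf
  obtain ⟨u, hu, hmin⟩ := (isCompact_closedBall (0 : E) 1).exists_isMinOn
    ⟨0, by simp⟩ hcont.continuousOn
  have hc : ∀ v : E, ‖v‖ ≤ 1 → f u ≤ f v := fun v hv => hmin (by simpa using hv)
  set c := f u
  set B := |c| + |f 0| + μ / 2 with hB
  have hBpos : 0 < B := by positivity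
  refine ⟨B ^ 2 / μ + |f 0| + |c| + μ / 4, fun x => ?_⟩
  have hq : B * ‖x‖ ≤ μ / 4 * ‖x‖ ^ 2 + B ^ 2 / μ := by
    have h1 : 0 ≤ (μ / 2 * ‖x‖ - B) ^ 2 / μ := by positivity
    have h2 : (μ / 2 * ‖x‖ - B) ^ 2 / μ = μ / 4 * ‖x‖ ^ 2 + B ^ 2 / μ - B * ‖x‖ := by
      field_simp
      ring
    linarith
  have hB2 : 0 ≤ B ^ 2 / μ := by positivity
  rcases le_total ‖x‖ 1 with h | h
  · have := hc x h
    have h3 : ‖x‖ ^ 2 ≤ 1 := by nlinarith [norm_nonneg x]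
    nlinarith [neg_abs_le c, abs_nonneg (f 0)]
  · have hpos : 0 < ‖x‖ := by linarith
    have h1 := hf x 0 (1 / ‖x‖) (by positivity) (by rw [div_le_one hpos]; exact h)
    have h2 : c ≤ f ((1 / ‖x‖) • x + (1 - 1 / ‖x‖) • (0 : E)) := by
      apply hc
      simp [norm_smul, hpos.ne']
    rw [sub_zero] at h1
    have h3 := le_trans h2 h1
    have h4 := mul_le_mul_of_nonneg_right h3 hpos.le
    have h5 : (1 / ‖x‖ * f x + (1 - 1 / ‖x‖) * f 0
        - μ / 2 * (1 / ‖x‖) * (1 - 1 / ‖x‖) * ‖x‖ ^ 2) * ‖x‖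
        = f x + (‖x‖ - 1) * f 0 - μ / 2 * (‖x‖ - 1) * ‖x‖ := by
      field_simp
    rw [h5] at h4
    have h6 : -(|c| * ‖x‖) ≤ c * ‖x‖ := by nlinarith [neg_abs_le c]
    have h7 : (‖x‖ - 1) * f 0 ≤ ‖x‖ * |f 0| := by
      nlinarith [le_abs_self (f 0), abs_nonneg (f 0)]
    nlinarith [abs_nonneg c, abs_nonneg (f 0)]

theorem aux_dual (μ : ℝ) (hμ : 0 < μ) (f : E → ℝ)
    (hf : ∀ x y : E, ∀ θ : ℝ, 0 ≤ θ → θ ≤ 1 →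
      f (θ • x + (1 - θ) • y)
        ≤ θ * f x + (1 - θ) * f y - μ / 2 * θ * (1 - θ) * ‖x - y‖ ^ 2)
    (T : E →L[ℝ] F) (b : F) (K : Set F)
    (hclosed : IsClosed K) (hconv : Convex ℝ K)
    (hcone : ∀ (c : ℝ), 0 ≤ c → ∀ x ∈ K, c • x ∈ K) (h0 : (0 : F) ∈ K)
    (M : ℝ) (hM : ∀ x, T x + b ∈ K → M < f x) :
    ∃ y : F, (∀ x ∈ K, 0 ≤ ⟪x, y⟫) ∧ ∀ x, ⟪y, T x + b⟫ - f x ≤ -M := by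
  have hcont := aux_cont μ hμ f hf
  obtain ⟨A, hA⟩ := aux_growth μ hμ f hf
  have hbdd : ∀ C x, f x ≤ C → ‖x‖ ≤ (C + A) * (4 / μ) + 1 := by
    intro C x hx
    have h1 := hA x
    have h2 : ‖x‖ ^ 2 ≤ (C + A) * (4 / μ) := by
      have : μ / 4 * ‖x‖ ^ 2 ≤ C + A := by linarith
      calc ‖x‖ ^ 2 = (μ / 4 * ‖x‖ ^ 2) * (4 / μ) := by field_simp
        _ ≤ _ := by gcongr
    nlinarith [sq_nonneg (‖x‖ - 1)]
  -- some penalty parameter works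
  have hk : ∃ k : ℕ, ∀ x, ∀ z ∈ K, M ≤ f x + ((k : ℝ) + 1) / 2 * ‖T x + b - z‖ ^ 2 := by
    by_contra! hcon
    choose xs zs hz hlt using hcon
    have hxs : ∀ k, f (xs k) ≤ M := fun k => by
      have : 0 ≤ ((k : ℝ) + 1) / 2 * ‖T (xs k) + b - zs k‖ ^ 2 := by positivity
      linarith [hlt k]
    have hxb : ∀ k, xs k ∈ Metric.closedBall (0 : E) ((M + A) * (4 / μ) + 1) := fun k => by
      simpa using hbdd M _ (hxs k)
    obtain ⟨x, -, φ, hφ, hlim⟩ := tendsto_subseq_of_bounded Metric.isBounded_closedBall hxb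
    have hr : ∀ k : ℕ, ‖T (xs k) + b - zs k‖ ^ 2 ≤ 2 * (M + A) * (1 / ((k : ℝ) + 1)) := fun k => by
      have h1 := hlt k
      have h2 : -A ≤ f (xs k) := by
        have := hA (xs k)
        have : 0 ≤ μ / 4 * ‖xs k‖ ^ 2 := by positivity
        linarith
      have hk : (0 : ℝ) < (k : ℝ) + 1 := by positivity
      rw [mul_one_div, le_div_iff₀ hk]
      nlinarith
    have hr0 : Tendsto (fun k => T (xs k) + b - zs k) atTop (𝓝 0) := by
      have h1 : Tendsto (fun k : ℕ => 2 * (M + A) * (1 / ((k : ℝ) + 1))) atTop (𝓝 0) := by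
        simpa using (tendsto_one_div_add_atTop_nhds_zero_nat (𝕜 := ℝ)).const_mul (2 * (M + A))
      have h2 : Tendsto (fun k => ‖T (xs k) + b - zs k‖ ^ 2) atTop (𝓝 0) :=
        squeeze_zero (fun k => by positivity) hr h1
      have h3 := h2.sqrt
      simp only [Real.sqrt_sq (norm_nonneg _), Real.sqrt_zero] at h3
      exact tendsto_zero_iff_norm_tendsto_zero.mpr h3
    have hTx : Tendsto (fun k => T (xs (φ k)) + b) atTop (𝓝 (T x + b)) :=
      ((T.continuous.tendsto x).comp hlim).add_const b
    have hzl : Tendsto (fun k => zs (φ k)) atTop (𝓝 (T x + b)) := by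
      have := hTx.sub (hr0.comp hφ.tendsto_atTop)
      simpa [Function.comp_def] using this
    have hmem : T x + b ∈ K := hclosed.mem_of_tendsto hzl (Eventually.of_forall fun k => hz _)
    have hle : f x ≤ M := le_of_tendsto ((hcont.tendsto x).comp hlim)
      (Eventually.of_forall fun k => hxs _)
    exact absurd (hM x hmem) (not_lt.mpr hle)
  obtain ⟨k₀, hk⟩ := hk
  obtain ⟨k, hkdef⟩ : ∃ k : ℝ, k = (k₀ : ℝ) + 1 := ⟨_, rfl⟩
  have hkpos : 0 < k := by rw [hkdef]; positivity
  rw [← hkdef] at hk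
  -- minimizer
  obtain ⟨⟨x, z⟩, hxz, hmin⟩ : ∃ p ∈ (Set.univ ×ˢ K : Set (E × F)), ∀ q ∈ (Set.univ ×ˢ K : Set (E × F)),
      f p.1 + k / 2 * ‖T p.1 + b - p.2‖ ^ 2 ≤ f q.1 + k / 2 * ‖T q.1 + b - q.2‖ ^ 2 := by
    set C := f 0 + k / 2 * ‖T 0 + b - 0‖ ^ 2 with hC
    set R1 := (C + A) * (4 / μ) + 1 with hR1
    set R2 := (C + A) * (2 / k) + 1 with hR2
    refine aux_exists_min (X := E × F) (fun p => f p.1 + k / 2 * ‖T p.1 + b - p.2‖ ^ 2)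
      (by fun_prop) _ (isClosed_univ.prod hclosed) (0, 0) ⟨trivial, h0⟩
      (max R1 (‖T‖ * R1 + ‖b‖ + R2)) ?_
    rintro ⟨x, z⟩ - hle
    change f x + k / 2 * ‖T x + b - z‖ ^ 2 ≤ C at hle
    have h1 : f x ≤ C := by
      have : 0 ≤ k / 2 * ‖T x + b - z‖ ^ 2 := by positivity
      linarith
    have hx := hbdd C x h1
    have h2 : -A ≤ f x := by
      have := hA x
      have : 0 ≤ μ / 4 * ‖x‖ ^ 2 := by positivity
      linarith
    have h3 : ‖T x + b - z‖ ≤ R2 := by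
      have h4 : ‖T x + b - z‖ ^ 2 ≤ (C + A) * (2 / k) := by
        have : k / 2 * ‖T x + b - z‖ ^ 2 ≤ C + A := by linarith
        calc ‖T x + b - z‖ ^ 2 = (k / 2 * ‖T x + b - z‖ ^ 2) * (2 / k) := by field_simp
          _ ≤ _ := by gcongr
      nlinarith [sq_nonneg (‖T x + b - z‖ - 1)]
    rw [Prod.norm_def]
    refine max_le_max hx ?_
    have h5 : ‖z‖ ≤ ‖T x + b‖ + ‖T x + b - z‖ := by
      have := norm_sub_le (T x + b) (T x + b - z)
      simpa using this
    have h6 : ‖T x + b‖ ≤ ‖T‖ * R1 + ‖b‖ := by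
      refine (norm_add_le _ _).trans ?_
      have := T.le_opNorm x
      have : ‖T‖ * ‖x‖ ≤ ‖T‖ * R1 := by gcongr
      linarith
    change ‖z‖ ≤ _
    linarith
  have hzK : z ∈ K := hxz.2
  obtain ⟨r, hr⟩ : ∃ r, r = T x + b - z := ⟨_, rfl⟩
  have hopt : ∀ x', ∀ w ∈ K, 0 ≤ f x' - f x + k * ⟪r, (T x' + b - w) - r⟫ := by
    intro x' w hw
    set q := (T x' + b - w) - r with hq
    have key : ∀ t : ℝ, 0 < t → t ≤ 1 → 0 ≤ f x' - f x + k * ⟪r, q⟫ + t * (k / 2 * ‖q‖ ^ 2) := by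
      intro t ht ht1
      have h1 := hmin (t • x' + (1 - t) • x, t • w + (1 - t) • z)
        ⟨trivial, hconv hw hzK ht.le (by linarith) (by ring)⟩
      simp only at h1
      have h2 := hf x' x t ht.le ht1
      have h3 : 0 ≤ μ / 2 * t * (1 - t) * ‖x' - x‖ ^ 2 := by
        have : 0 ≤ 1 - t := by linarith
        positivity
      have h4 : T (t • x' + (1 - t) • x) + b - (t • w + (1 - t) • z) = r + t • q := by
        rw [hq, hr, map_add, map_smul, map_smul]
        module
      rw [h4, ← hr, norm_add_sq_real, inner_smul_right, norm_smul, Real.norm_of_nonneg ht.le] at h1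
      have h5 : 0 ≤ t * (f x' - f x + k * ⟪r, q⟫ + t * (k / 2 * ‖q‖ ^ 2)) := by
        nlinarith
      exact nonneg_of_mul_nonneg_right h5 ht
    have hl : Tendsto (fun t : ℝ => f x' - f x + k * ⟪r, q⟫ + t * (k / 2 * ‖q‖ ^ 2)) (𝓝[>] 0)
        (𝓝 (f x' - f x + k * ⟪r, q⟫)) := by
      have : Continuous (fun t : ℝ => f x' - f x + k * ⟪r, q⟫ + t * (k / 2 * ‖q‖ ^ 2)) := by
        fun_prop
      have h := this.tendsto 0
      simp only [zero_mul, add_zero] at h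
      exact h.mono_left nhdsWithin_le_nhds
    refine ge_of_tendsto hl ?_
    filter_upwards [Ioc_mem_nhdsGT (zero_lt_one' ℝ)] with t ht
    exact key t ht.1 ht.2
  refine ⟨-(k • r), ?_, ?_⟩
  · intro w hw
    have hzw : z + w ∈ K := by
      have := hcone 2 (by norm_num) _ (hconv hzK hw (by norm_num : (0 : ℝ) ≤ 1 / 2)
        (by norm_num : (0 : ℝ) ≤ 1 / 2) (by norm_num))
      convert this using 1
      module
    have h := hopt x (z + w) hzw
    have h2 : T x + b - (z + w) - r = -w := by rw [hr]; abel
    rw [h2, inner_neg_right] at h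
    rw [inner_neg_right, inner_smul_right, real_inner_comm]
    linarith
  · intro x'
    have h := hopt x' 0 h0
    rw [sub_zero, inner_sub_right, real_inner_self_eq_norm_sq] at h
    have h2 := hk x z hzK
    rw [← hr] at h2
    rw [inner_neg_left, real_inner_smul_left]
    have : 0 ≤ k / 2 * ‖r‖ ^ 2 := by positivity
    nlinarith

theorem aux_slater (K : Set F) (u : F) (hu : u ∈ interior K) :
    ∃ ε > 0, ∀ y : F, (∀ x ∈ K, 0 ≤ ⟪x, y⟫) → ε * ‖y‖ ≤ ⟪y, u⟫ := by
  obtain ⟨ε, hε, hball⟩ := Metric.isOpen_iff.mp isOpen_interior u hu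
  refine ⟨ε / 2, by positivity, fun y hy => ?_⟩
  rcases eq_or_ne y 0 with rfl | hne
  · simp
  have hn : 0 < ‖y‖ := norm_pos_iff.mpr hne
  have hm : u - (ε / 2 / ‖y‖) • y ∈ K := by
    apply interior_subset
    apply hball
    rw [Metric.mem_ball, dist_eq_norm, sub_sub_cancel_left, norm_neg, norm_smul,
      Real.norm_of_nonneg (by positivity)]
    field_simp
    linarith
  have h := hy _ hm
  rw [inner_sub_left, real_inner_smul_left, real_inner_self_eq_norm_sq, real_inner_comm] at h
  have h2 : ε / 2 / ‖y‖ * ‖y‖ ^ 2 = ε / 2 * ‖y‖ := by field_simp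
  linarith

end aux


/-- Strong duality for `min {f(x) : Tx + b ∈ K}` with `f`
`μ`-strongly convex and `K` a regular closed convex cone: with extended-real optimal
values `p*` of the primal and `d*` of the dual `min {f*(T*y) + ⟨b,y⟩ : y ∈ K*}`:
(i) `p* + d* = 0`; (ii) primal feasibility implies both values are finite and `p*` is
attained; (iii) Slater's condition implies both values are finite and attained. -/
theorem stmt_9 {n m : ℕ} (μ : ℝ) (hμ : 0 < μ)
    (f : EuclideanSpace ℝ (Fin n) → ℝ)
    (hf : ∀ x y : EuclideanSpace ℝ (Fin n), ∀ θ : ℝ, 0 ≤ θ → θ ≤ 1 →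
      f (θ • x + (1 - θ) • y)
        ≤ θ * f x + (1 - θ) * f y - μ / 2 * θ * (1 - θ) * ‖x - y‖ ^ 2)
    (T : EuclideanSpace ℝ (Fin n) →L[ℝ] EuclideanSpace ℝ (Fin m))
    (b : EuclideanSpace ℝ (Fin m)) (K : Set (EuclideanSpace ℝ (Fin m)))
    (hclosed : IsClosed K) (hconv : Convex ℝ K)
    (hcone : ∀ (c : ℝ), 0 ≤ c → ∀ x ∈ K, c • x ∈ K)
    (hpointed : K ∩ (-K) = {0}) (hfull : (interior K).Nonempty)
    (pstar dstar : EReal)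
    (hp : pstar = sInf ((fun x => (f x : EReal)) '' {x | T x + b ∈ K}))
    (hd : dstar = sInf ((fun y =>
        ((fenchelConj f (ContinuousLinearMap.adjoint T y) + ⟪b, y⟫ : ℝ) : EReal)) ''
        {y | ∀ x ∈ K, 0 ≤ ⟪x, y⟫})) :
    pstar = -dstar ∧
    ((∃ x, T x + b ∈ K) →
      pstar ≠ ⊤ ∧ pstar ≠ ⊥ ∧ dstar ≠ ⊤ ∧ dstar ≠ ⊥ ∧
        ∃ x, T x + b ∈ K ∧ (f x : EReal) = pstar) ∧
    ((∃ x, T x + b ∈ interior K) →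
      pstar ≠ ⊤ ∧ pstar ≠ ⊥ ∧ dstar ≠ ⊤ ∧ dstar ≠ ⊥ ∧
        (∃ x, T x + b ∈ K ∧ (f x : EReal) = pstar) ∧
        ∃ y, (∀ x ∈ K, 0 ≤ ⟪x, y⟫) ∧
          ((fenchelConj f (ContinuousLinearMap.adjoint T y) + ⟪b, y⟫ : ℝ) : EReal)
            = dstar) := by
  have h0 : (0 : EuclideanSpace ℝ (Fin m)) ∈ K := by
    obtain ⟨u, hu⟩ := hfull
    simpa using hcone 0 le_rfl u (interior_subset hu)
  have hcont := aux_cont μ hμ f hf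
  obtain ⟨A, hA⟩ := aux_growth μ hμ f hf
  have hA' : ∀ x, -A ≤ f x := fun x => by
    have := hA x
    have : 0 ≤ μ / 4 * ‖x‖ ^ 2 := by positivity
    linarith
  -- conjugate facts
  have hbd : ∀ s, BddAbove (Set.range fun x => ⟪s, x⟫ - f x) := by
    intro s
    refine ⟨‖s‖ ^ 2 / μ + A, ?_⟩
    rintro _ ⟨x, rfl⟩
    have h1 := hA x
    have h2 := real_inner_le_norm s x
    have h3 : 0 ≤ (μ / 2 * ‖x‖ - ‖s‖) ^ 2 / μ := by positivity
    have h4 : (μ / 2 * ‖x‖ - ‖s‖) ^ 2 / μ = μ / 4 * ‖x‖ ^ 2 + ‖s‖ ^ 2 / μ - ‖s‖ * ‖x‖ := by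
      field_simp
      ring
    change ⟪s, x⟫ - f x ≤ _
    linarith
  set φ : EuclideanSpace ℝ (Fin m) → ℝ :=
    fun y => fenchelConj f (ContinuousLinearMap.adjoint T y) + ⟪b, y⟫ with hφ
  have hident : ∀ x y, ⟪ContinuousLinearMap.adjoint T y, x⟫ - f x + ⟪b, y⟫
      = ⟪y, T x + b⟫ - f x := by
    intro x y
    rw [ContinuousLinearMap.adjoint_inner_left, inner_add_right, real_inner_comm b y]
    ring
  have hφle : ∀ y c, (∀ x, ⟪y, T x + b⟫ - f x ≤ c) → φ y ≤ c := by
    intro y c h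
    have : fenchelConj f (ContinuousLinearMap.adjoint T y) ≤ c - ⟪b, y⟫ := by
      refine ciSup_le fun x => ?_
      have := hident x y
      have := h x
      linarith
    simp only [hφ]
    linarith
  have hφge : ∀ y x, ⟪y, T x + b⟫ - f x ≤ φ y := by
    intro y x
    have : ⟪ContinuousLinearMap.adjoint T y, x⟫ - f x
        ≤ fenchelConj f (ContinuousLinearMap.adjoint T y) :=
      le_ciSup (hbd (ContinuousLinearMap.adjoint T y)) x
    have := hident x y
    simp only [hφ]
    linarith
  have hple : ∀ x, T x + b ∈ K → pstar ≤ (f x : EReal) := by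
    intro x hx
    rw [hp]
    exact sInf_le ⟨x, hx, rfl⟩
  have hdle : ∀ y, (∀ x ∈ K, 0 ≤ ⟪x, y⟫) → dstar ≤ (φ y : EReal) := by
    intro y hy
    rw [hd]
    exact sInf_le ⟨y, hy, rfl⟩
  have hi : pstar = -dstar := by
    apply le_antisymm
    · refine EReal.le_neg_of_le_neg ?_
      rw [← EReal.le_of_forall_lt_iff_le]
      intro z hz
      have hz' : ((-z : ℝ) : EReal) < pstar := by
        rw [EReal.coe_neg]
        exact EReal.neg_lt_comm.mp hz
      obtain ⟨y, hy, hyle⟩ := aux_dual μ hμ f hf T b K hclosed hconv hcone h0 (-z)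
        (fun x hx => by exact_mod_cast hz'.trans_le (hple x hx))
      refine (hdle y hy).trans ?_
      have := hφle y _ hyle
      rw [neg_neg] at this
      exact_mod_cast this
    · rw [hp]
      refine le_sInf ?_
      rintro _ ⟨x, hx, rfl⟩
      refine EReal.neg_le_of_neg_le ?_
      rw [hd]
      refine le_sInf ?_
      rintro _ ⟨y, hy, rfl⟩
      have h1 := hφge y x
      have h2 := hy _ hx
      rw [real_inner_comm] at h2
      have h3 : -(f x) ≤ φ y := by linarith
      change -((f x : ℝ) : EReal) ≤ ((φ y : ℝ) : EReal)
      rw [← EReal.coe_neg]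
      exact_mod_cast h3
  have hatt : (∃ x, T x + b ∈ K) → ∃ x, T x + b ∈ K ∧ (f x : EReal) = pstar := by
    rintro ⟨x0, hx0⟩
    obtain ⟨x, hx, hmin⟩ := aux_exists_min f hcont {x | T x + b ∈ K}
      (hclosed.preimage (by fun_prop : Continuous fun x => T x + b)) x0 hx0
      ((f x0 + A) * (4 / μ) + 1) (by
        intro x _ hx
        have h1 := hA x
        have h2 : ‖x‖ ^ 2 ≤ (f x0 + A) * (4 / μ) := by
          have : μ / 4 * ‖x‖ ^ 2 ≤ f x0 + A := by linarith
          calc ‖x‖ ^ 2 = (μ / 4 * ‖x‖ ^ 2) * (4 / μ) := by field_simp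
            _ ≤ _ := by gcongr
        nlinarith [sq_nonneg (‖x‖ - 1)])
    refine ⟨x, hx, le_antisymm ?_ (hple x hx)⟩
    rw [hp]
    refine le_sInf ?_
    rintro _ ⟨y, hy, rfl⟩
    exact EReal.coe_le_coe_iff.mpr (hmin y hy)
  have hii : (∃ x, T x + b ∈ K) →
      pstar ≠ ⊤ ∧ pstar ≠ ⊥ ∧ dstar ≠ ⊤ ∧ dstar ≠ ⊥ ∧
        ∃ x, T x + b ∈ K ∧ (f x : EReal) = pstar := by
    intro h
    obtain ⟨x, hx, hxp⟩ := hatt h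
    have hdx : dstar = ((-(f x) : ℝ) : EReal) := by
      rw [EReal.coe_neg, hxp, hi, neg_neg]
    refine ⟨?_, ?_, ?_, ?_, x, hx, hxp⟩
    · rw [← hxp]; exact EReal.coe_ne_top _
    · rw [← hxp]; exact EReal.coe_ne_bot _
    · rw [hdx]; exact EReal.coe_ne_top _
    · rw [hdx]; exact EReal.coe_ne_bot _
  refine ⟨hi, hii, ?_⟩
  rintro ⟨xb, hxb⟩
  obtain ⟨p1, p2, d1, d2, x, hx, hxp⟩ := hii ⟨xb, interior_subset hxb⟩
  refine ⟨p1, p2, d1, d2, ⟨x, hx, hxp⟩, ?_⟩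
  have hdx : dstar = ((-(f x) : ℝ) : EReal) := by
    rw [EReal.coe_neg, hxp, hi, neg_neg]
  have hfx : ∀ x', T x' + b ∈ K → f x ≤ f x' := by
    intro x' hx'
    have := hple x' hx'
    rw [← hxp] at this
    exact_mod_cast this
  have hseq : ∀ k : ℕ, ∃ y : EuclideanSpace ℝ (Fin m), (∀ x ∈ K, 0 ≤ ⟪x, y⟫) ∧
      ∀ x', ⟪y, T x' + b⟫ - f x' ≤ -(f x - 1 / ((k : ℝ) + 1)) := by
    intro k
    refine aux_dual μ hμ f hf T b K hclosed hconv hcone h0 _ fun x' hx' => ?_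
    have := hfx x' hx'
    have : 0 < 1 / ((k : ℝ) + 1) := by positivity
    linarith
  choose ys hys hyle using hseq
  obtain ⟨ε, hε, hsl⟩ := aux_slater K _ hxb
  have hyb : ∀ k, ys k ∈ Metric.closedBall (0 : EuclideanSpace ℝ (Fin m))
      ((f xb - f x + 1) / ε) := by
    intro k
    have h1 := hsl _ (hys k)
    have h2 := hyle k xb
    have h3 : 1 / ((k : ℝ) + 1) ≤ 1 := by
      rw [div_le_one (by positivity)]
      linarith [(Nat.cast_nonneg k : (0 : ℝ) ≤ k)]
    rw [mem_closedBall_zero_iff, le_div_iff₀ hε]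
    linarith
  obtain ⟨y, -, ψ, hψ, hlim⟩ := tendsto_subseq_of_bounded Metric.isBounded_closedBall hyb
  have hyK : ∀ x ∈ K, 0 ≤ ⟪x, y⟫ := by
    intro w hw
    have hc : Continuous fun v : EuclideanSpace ℝ (Fin m) => ⟪w, v⟫ := by fun_prop
    exact ge_of_tendsto ((hc.tendsto y).comp hlim)
      (Filter.Eventually.of_forall fun k => hys _ w hw)
  refine ⟨y, hyK, le_antisymm ?_ (hdle y hyK)⟩
  rw [hdx]
  have : φ y ≤ -(f x) := by
    refine hφle y _ fun x' => ?_
    have hc : Continuous fun v : EuclideanSpace ℝ (Fin m) => ⟪v, T x' + b⟫ - f x' := by fun_prop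
    have hr : Filter.Tendsto (fun k : ℕ => -(f x - 1 / ((ψ k : ℝ) + 1))) Filter.atTop
        (nhds (-(f x))) := by
      have := (((tendsto_one_div_add_atTop_nhds_zero_nat (𝕜 := ℝ)).comp
        hψ.tendsto_atTop).const_sub (f x)).neg
      simpa [Function.comp_def] using this
    exact le_of_tendsto_of_tendsto' ((hc.tendsto y).comp hlim) hr fun k => hyle _ x'
  exact_mod_cast this
end

section
/- Let K = Λ(p,e) ⊆ ℝ^m be a regular hyperbolicity cone, c_D > 0 and w ∈ ℝ^m, and set t_opt := min(0, λ_min(w)) and z_opt := w − t_opt e. If t_opt < 0, then with r := mult(z_opt), the inner product ⟨e, ∇p^{(r−1)}(z_opt)⟩ is nonzero and the vector (c_D / ⟨e, ∇p^{(r−1)}(z_opt)⟩) · ∇p^{(r−1)}(z_opt) is an optimal solution of the conic program min{⟨w, s⟩ : s ∈ K*, ⟨e, s⟩ ≤ c_D}. -/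
open scoped RealInnerProductSpace

/-- The polynomial `P` as a function on `EuclideanSpace ℝ (Fin m)`. -/
noncomputable def pfun {m : ℕ} (P : MvPolynomial (Fin m) ℝ) :
    EuclideanSpace ℝ (Fin m) → ℝ :=
  fun y => MvPolynomial.eval (fun i => y i) P

/-- Directional derivative operator along `e`: `(dirDeriv e g)(y) = D_e g(y)`. -/
noncomputable def dirDeriv {m : ℕ} (e : EuclideanSpace ℝ (Fin m))
    (g : EuclideanSpace ℝ (Fin m) → ℝ) : EuclideanSpace ℝ (Fin m) → ℝ :=
  fun y => fderiv ℝ g y e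

section helpers
variable {m d : ℕ}

noncomputable def pcx (P : MvPolynomial (Fin m) ℝ) (v : Fin m → ℂ) : ℂ := MvPolynomial.aeval v P

def cst (x : EuclideanSpace ℝ (Fin m)) : Fin m → ℂ := fun i => ((x i : ℝ) : ℂ)

lemma cst_add (x y : EuclideanSpace ℝ (Fin m)) : cst (x + y) = cst x + cst y := by
  ext i; simp [cst]

lemma cst_smul (c : ℝ) (y : EuclideanSpace ℝ (Fin m)) : cst (c • y) = (c : ℂ) • cst y := by
  ext i; simp [cst]

lemma pcx_cst (P : MvPolynomial (Fin m) ℝ) (x : EuclideanSpace ℝ (Fin m)) :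
    pcx P (cst x) = ((pfun P x : ℝ) : ℂ) := by
  have := MvPolynomial.aeval_algebraMap_apply (A := ℝ) ℂ (fun i => x i) P
  have hx : cst x = fun i => ((x i : ℝ) : ℂ) := rfl
  rw [hx]
  simpa [pcx, pfun, Function.comp_def, MvPolynomial.aeval_eq_eval] using this

lemma pcx_cont (P : MvPolynomial (Fin m) ℝ) : Continuous (pcx P) := by
  have : pcx P = fun v => MvPolynomial.eval v (MvPolynomial.map (algebraMap ℝ ℂ) P) := by
    ext v; simp [pcx, MvPolynomial.eval_map, MvPolynomial.aeval_def]
  rw [this]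
  exact MvPolynomial.continuous_eval _

lemma pcx_hom {P : MvPolynomial (Fin m) ℝ} (h : P.IsHomogeneous d) (c : ℂ) (v : Fin m → ℂ) :
    pcx P (c • v) = c ^ d * pcx P v := by
  unfold pcx
  rw [MvPolynomial.aeval_def, MvPolynomial.aeval_def, MvPolynomial.eval₂_eq, MvPolynomial.eval₂_eq,
    Finset.mul_sum]
  refine Finset.sum_congr rfl fun s hs => ?_
  have := h (MvPolynomial.mem_support_iff.mp hs)
  rw [Finsupp.weight_apply, Finsupp.sum] at this
  simp only [Pi.smul_apply, smul_eq_mul, mul_pow, Finset.prod_mul_distrib, Finset.prod_pow_eq_pow_sum]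
  have h3 : ∑ i ∈ s.support, s i = d := by simpa using this
  rw [h3]; ring

lemma pfun_hom {P : MvPolynomial (Fin m) ℝ} (h : P.IsHomogeneous d) (c : ℝ)
    (v : EuclideanSpace ℝ (Fin m)) :
    pfun P (c • v) = c ^ d * pfun P v := by
  have := pcx_hom h c (cst v)
  rw [← cst_smul, pcx_cst, pcx_cst] at this
  exact_mod_cast this

noncomputable def lnp (P : MvPolynomial (Fin m) ℝ) (a b : Fin m → ℂ) : Polynomial ℂ :=
  MvPolynomial.aeval (fun i => Polynomial.C (a i) + Polynomial.X * Polynomial.C (b i)) P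

lemma lnp_eval (P : MvPolynomial (Fin m) ℝ) (a b : Fin m → ℂ) (t : ℂ) :
    (lnp P a b).eval t = pcx P (a + t • b) := by
  have := MvPolynomial.comp_aeval_apply (R := ℝ)
    (fun i => Polynomial.C (a i) + Polynomial.X * Polynomial.C (b i))
    ((Polynomial.aeval (R := ℂ) t).restrictScalars ℝ) P
  simp only [AlgHom.restrictScalars_apply, Polynomial.coe_aeval_eq_eval] at this
  rw [lnp, this, pcx]
  congr 2
  ext i
  simp
  ring

lemma lnp_deg {P : MvPolynomial (Fin m) ℝ} (h : P.IsHomogeneous d) (a b : Fin m → ℂ) :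
    (lnp P a b).natDegree ≤ d := by
  have := MvPolynomial.aeval_natDegree_le (MvPolynomial.map (algebraMap ℝ ℂ) P) (m := d)
    (h.map (algebraMap ℝ ℂ)).totalDegree_le
    (fun i => Polynomial.C (a i) + Polynomial.X * Polynomial.C (b i)) (n := 1) (by
      intro i; compute_degree)
  simpa [lnp, MvPolynomial.aeval_map_algebraMap] using this

lemma lower_bd {P : MvPolynomial (Fin m) ℝ} (h : P.IsHomogeneous d) (b v : Fin m → ℂ)
    (hv : pcx P v ≠ 0) (hb : ∀ t : ℂ, 0 ≤ t.im → pcx P (b + t • v) ≠ 0) (t₀ : ℂ) (ht : 0 < t₀.im) :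
    ‖pcx P v‖ * ‖t₀‖ ^ d * (t₀.im / ‖t₀‖) ^ d ≤ ‖pcx P (b + t₀ • v)‖ := by
  have ht0 : t₀ ≠ 0 := by rintro rfl; simp at ht
  have hn : 0 < ‖t₀‖ := norm_pos_iff.mpr ht0
  set H := lnp P v b with hH
  have hH0 : H.eval 0 = pcx P v := by simp [hH, lnp_eval]
  have hsp := IsAlgClosed.splits H
  have hfac : ∀ σ : ℂ, H.eval σ = H.leadingCoeff * (H.roots.map (fun a => σ - a)).prod := by
    intro σ
    exact hsp.eval_eq_prod_roots σ
  have hrt : ∀ a ∈ H.roots, a ≠ 0 ∧ (a⁻¹).im < 0 := by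
    intro a ha
    have h1 : H.eval a = 0 := (Polynomial.mem_roots'.mp ha).2
    have ha0 : a ≠ 0 := by rintro rfl; exact hv (hH0 ▸ h1)
    refine ⟨ha0, ?_⟩
    by_contra hc
    apply hb a⁻¹ (not_lt.mp hc)
    rw [hH, lnp_eval] at h1
    have : b + a⁻¹ • v = a⁻¹ • (v + a • b) := by
      rw [smul_add, smul_smul, inv_mul_cancel₀ ha0, one_smul, add_comm]
    rw [this, pcx_hom h, h1, mul_zero]
  have key : ∀ s : Multiset ℂ, (∀ a ∈ s, a ≠ 0 ∧ (a⁻¹).im < 0) →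
      ‖(s.map (fun a => 0 - a)).prod‖ * (t₀.im / ‖t₀‖) ^ s.card ≤
        ‖(s.map (fun a => t₀⁻¹ - a)).prod‖ := by
    intro s
    induction s using Multiset.induction_on with
    | empty => simp
    | cons a s ih =>
      intro hs
      have ih' := ih (fun x hx => hs x (Multiset.mem_cons_of_mem hx))
      obtain ⟨ha0, ha⟩ := hs a (Multiset.mem_cons_self _ _)
      have h1 : ‖0 - a‖ * (t₀.im / ‖t₀‖) ≤ ‖t₀⁻¹ - a‖ := by
        have e1 : t₀⁻¹ - a = a * (a⁻¹ - t₀) * t₀⁻¹ := by field_simp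
        have e2 : t₀.im ≤ ‖a⁻¹ - t₀‖ := by
          have := Complex.abs_im_le_norm (a⁻¹ - t₀)
          rw [Complex.sub_im] at this
          have h3 := neg_abs_le ((a⁻¹).im - t₀.im)
          linarith
        rw [e1, norm_mul, norm_mul, norm_inv, zero_sub, norm_neg, div_eq_mul_inv, mul_assoc]
        gcongr
      simp only [Multiset.map_cons, Multiset.prod_cons, norm_mul, Multiset.card_cons, pow_succ]
      calc _ = (‖0 - a‖ * (t₀.im / ‖t₀‖)) *
          (‖(s.map (fun a => 0 - a)).prod‖ * (t₀.im / ‖t₀‖) ^ s.card) := by ring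
        _ ≤ _ := by gcongr
  have k := key H.roots hrt
  have hle1 : t₀.im / ‖t₀‖ ≤ 1 := by
    rw [div_le_one hn]
    exact (le_abs_self _).trans (Complex.abs_im_le_norm _)
  have hcard : H.roots.card ≤ d := (Polynomial.card_roots' H).trans (lnp_deg h v b)
  have e3 : b + t₀ • v = t₀ • (v + t₀⁻¹ • b) := by
    rw [smul_add, smul_smul, mul_inv_cancel₀ ht0, one_smul, add_comm]
  rw [e3, pcx_hom h, ← lnp_eval, ← hH, ← hH0, hfac, hfac, norm_mul, norm_mul, norm_mul, norm_pow]
  have : (t₀.im / ‖t₀‖) ^ d ≤ (t₀.im / ‖t₀‖) ^ H.roots.card :=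
    pow_le_pow_of_le_one (by positivity) hle1 hcard
  calc _ = ‖t₀‖ ^ d * (‖H.leadingCoeff‖ * (‖(H.roots.map (fun a => 0 - a)).prod‖
        * (t₀.im / ‖t₀‖) ^ d)) := by ring
    _ ≤ ‖t₀‖ ^ d * (‖H.leadingCoeff‖ * (‖(H.roots.map (fun a => 0 - a)).prod‖
        * (t₀.im / ‖t₀‖) ^ H.roots.card)) := by gcongr
    _ ≤ _ := by gcongr

lemma homotopy {P : MvPolynomial (Fin m) ℝ} (h : P.IsHomogeneous d) (b₀ b₁ v : Fin m → ℂ)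
    (hv : pcx P v ≠ 0)
    (hreal : ∀ τ ∈ Set.Icc (0:ℝ) 1, ∀ t : ℝ, pcx P (b₀ + (τ:ℂ) • b₁ + (t:ℂ) • v) ≠ 0)
    (h0 : ∀ t : ℂ, 0 ≤ t.im → pcx P (b₀ + t • v) ≠ 0) :
    ∀ t : ℂ, 0 ≤ t.im → pcx P (b₀ + b₁ + t • v) ≠ 0 := by
  have hc := pcx_cont P
  obtain ⟨δ, hδ, hball⟩ : ∃ δ > 0, ∀ y, dist y v < δ → pcx P y ≠ 0 := by
    have := hc.continuousAt.eventually_ne hv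
    exact Metric.eventually_nhds_iff.mp this
  set M := ‖b₀‖ + ‖b₁‖ with hM
  have hM0 : 0 ≤ M := by positivity
  have hbd : ∀ τ ∈ Set.Icc (0:ℝ) 1, ∀ t : ℂ, pcx P (b₀ + (τ:ℂ) • b₁ + t • v) = 0 → ‖t‖ ≤ M / δ := by
    intro τ hτ t ht
    by_contra hcon
    push Not at hcon
    have htp : 0 < ‖t‖ := lt_of_le_of_lt (by positivity) hcon
    have ht0 : t ≠ 0 := norm_pos_iff.mp htp
    have e3 : b₀ + (τ:ℂ) • b₁ + t • v = t • (v + t⁻¹ • (b₀ + (τ:ℂ) • b₁)) := by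
      rw [smul_add, smul_smul t t⁻¹, mul_inv_cancel₀ ht0, one_smul, add_comm]
    rw [e3, pcx_hom h] at ht
    have := hball (v + t⁻¹ • (b₀ + (τ:ℂ) • b₁)) (by
      rw [dist_eq_norm, add_sub_cancel_left, norm_smul, norm_inv]
      have h1 : ‖b₀ + (τ:ℂ) • b₁‖ ≤ M := by
        refine (norm_add_le _ _).trans ?_
        rw [norm_smul, Complex.norm_real, Real.norm_eq_abs, abs_of_nonneg hτ.1]
        have := mul_le_of_le_one_left (norm_nonneg b₁) hτ.2
        linarith
      rw [inv_mul_lt_iff₀ htp]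
      rw [div_lt_iff₀ hδ] at hcon
      linarith)
    exact (mul_ne_zero (pow_ne_zero _ ht0) this) ht
  set Z : Set (ℝ × ℂ) := (Set.Icc (0:ℝ) 1 ×ˢ Metric.closedBall (0:ℂ) (M/δ)) ∩
    ({x | 0 ≤ x.2.im} ∩ {x | pcx P (b₀ + (x.1:ℂ) • b₁ + x.2 • v) = 0}) with hZ
  have hZc : IsCompact Z := by
    apply IsCompact.inter_right (isCompact_Icc.prod (isCompact_closedBall _ _))
    apply IsClosed.inter
    · exact isClosed_le continuous_const (Complex.continuous_im.comp continuous_snd)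
    · refine isClosed_eq (hc.comp ?_) continuous_const
      fun_prop
  have hmem : ∀ τ ∈ Set.Icc (0:ℝ) 1, ∀ t : ℂ, 0 ≤ t.im →
      pcx P (b₀ + (τ:ℂ) • b₁ + t • v) = 0 → (τ, t) ∈ Z := by
    intro τ hτ t ht hz
    exact ⟨⟨hτ, by simpa using hbd τ hτ t hz⟩, ht, hz⟩
  intro t ht hz
  have hne : Z.Nonempty := ⟨(1, t), hmem 1 (by simp) t ht (by simpa using hz)⟩
  obtain ⟨⟨τ₀, t₀⟩, hin, hmin⟩ := hZc.exists_isMinOn hne continuous_fst.continuousOn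
  obtain ⟨⟨hτ, -⟩, him, hz0⟩ := hin
  simp only [Set.mem_ofPred_eq] at him hz0 hτ
  have hτpos : 0 < τ₀ := by
    rcases hτ.1.lt_or_eq with h' | h'
    · exact h'
    · exfalso; rw [← h'] at hz0; exact h0 t₀ him (by simpa using hz0)
  have himpos : 0 < t₀.im := by
    rcases him.lt_or_eq with h' | h'
    · exact h'
    · exfalso
      apply hreal τ₀ hτ t₀.re
      have : ((t₀.re : ℝ) : ℂ) = t₀ := by apply Complex.ext <;> simp [← h']
      rw [this]; exact hz0
  have hev : ∀ᶠ τ : ℝ in nhdsWithin τ₀ (Set.Iio τ₀), ‖pcx P v‖ * ‖t₀‖ ^ d * (t₀.im / ‖t₀‖) ^ d ≤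
      ‖pcx P (b₀ + (τ:ℂ) • b₁ + t₀ • v)‖ := by
    filter_upwards [Ioo_mem_nhdsLT hτpos] with τ hτ'
    refine lower_bd h _ v hv ?_ t₀ himpos
    intro t' ht' hz'
    have := hmin (hmem τ ⟨hτ'.1.le, hτ'.2.le.trans hτ.2⟩ t' ht' hz')
    simp only [Set.mem_ofPred_eq] at this
    exact absurd hτ'.2 (not_lt.mpr this)
  have hcont : Continuous fun τ : ℝ => ‖pcx P (b₀ + (τ:ℂ) • b₁ + t₀ • v)‖ := by
    refine (hc.comp ?_).norm
    fun_prop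
  have := ge_of_tendsto ((hcont.tendsto τ₀).mono_left nhdsWithin_le_nhds) hev
  simp only [hz0, norm_zero] at this
  have ht0 : t₀ ≠ 0 := by rintro rfl; simp at himpos
  have : 0 < ‖pcx P v‖ * ‖t₀‖ ^ d * (t₀.im / ‖t₀‖) ^ d := by
    have h1 := norm_pos_iff.mpr hv
    have h2 := norm_pos_iff.mpr ht0
    positivity
  linarith


lemma pcx_line {P : MvPolynomial (Fin m) ℝ} {e : EuclideanSpace ℝ (Fin m)}
    {lm : EuclideanSpace ℝ (Fin m) → Fin d → ℝ}
    (hl : ∀ (x : EuclideanSpace ℝ (Fin m)) (t : ℝ),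
      pfun P (x + t • e) = pfun P e * ∏ i, (lm x i + t))
    (x : EuclideanSpace ℝ (Fin m)) (c : ℂ) :
    pcx P (cst x + c • cst e) = (pfun P e : ℂ) * ∏ i, ((lm x i : ℂ) + c) := by
  have h : lnp P (cst x) (cst e) =
      Polynomial.C (pfun P e : ℂ) * ∏ i, (Polynomial.C (lm x i : ℂ) + Polynomial.X) := by
    apply Polynomial.eq_of_infinite_eval_eq
    refine (Set.infinite_range_of_injective Complex.ofReal_injective).mono ?_
    rintro _ ⟨t, rfl⟩
    simp only [Set.mem_ofPred_eq]
    rw [lnp_eval, ← cst_smul, ← cst_add, pcx_cst, hl]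
    simp [Polynomial.eval_prod]
  rw [← lnp_eval, h]
  simp [Polynomial.eval_prod]

/-- strict cone -/
def K0 (P : MvPolynomial (Fin m) ℝ) (e : EuclideanSpace ℝ (Fin m)) :
    Set (EuclideanSpace ℝ (Fin m)) := {x | ∀ s : ℝ, 0 ≤ s → pfun P (x + s • e) ≠ 0}

lemma gard0 {P : MvPolynomial (Fin m) ℝ} {e : EuclideanSpace ℝ (Fin m)}
    {lm : EuclideanSpace ℝ (Fin m) → Fin d → ℝ} (hpe : pfun P e ≠ 0)
    (hl : ∀ (x : EuclideanSpace ℝ (Fin m)) (t : ℝ),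
      pfun P (x + t • e) = pfun P e * ∏ i, (lm x i + t))
    {x : EuclideanSpace ℝ (Fin m)} (hx : x ∈ K0 P e) (c : ℂ) (hc : c.im ≠ 0 ∨ 0 ≤ c.re) :
    pcx P (cst x + c • cst e) ≠ 0 := by
  intro h0
  rw [pcx_line hl] at h0
  have hpe' : (pfun P e : ℂ) ≠ 0 := by exact_mod_cast hpe
  obtain ⟨i, -, hi⟩ := Finset.prod_eq_zero_iff.mp ((mul_eq_zero.mp h0).resolve_left hpe')
  have h1 := congrArg Complex.re hi
  have h2 := congrArg Complex.im hi
  simp at h1 h2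
  have h3 : 0 ≤ c.re := hc.resolve_left (by simp [h2])
  apply hx _ h3
  rw [hl]
  apply mul_eq_zero_of_right
  exact Finset.prod_eq_zero (Finset.mem_univ i) h1

lemma gard_start {P : MvPolynomial (Fin m) ℝ} {e : EuclideanSpace ℝ (Fin m)}
    {lm : EuclideanSpace ℝ (Fin m) → Fin d → ℝ} (h : P.IsHomogeneous d) (hpe : pfun P e ≠ 0)
    (hl : ∀ (x : EuclideanSpace ℝ (Fin m)) (t : ℝ),
      pfun P (x + t • e) = pfun P e * ∏ i, (lm x i + t))
    {x : EuclideanSpace ℝ (Fin m)} (hx : x ∈ K0 P e) (t : ℂ) (ht : 0 ≤ t.im) :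
    pcx P (Complex.I • cst e + t • cst x) ≠ 0 := by
  have hpe' : pcx P (cst e) ≠ 0 := by rw [pcx_cst]; exact_mod_cast hpe
  by_cases ht0 : t = 0
  · subst ht0
    rw [zero_smul, add_zero, pcx_hom h]
    exact mul_ne_zero (pow_ne_zero _ Complex.I_ne_zero) hpe'
  · have e1 : Complex.I • cst e + t • cst x = t • (cst x + (Complex.I / t) • cst e) := by
      rw [smul_add, smul_smul, mul_div_cancel₀ _ ht0, add_comm]
    rw [e1, pcx_hom h]
    refine mul_ne_zero (pow_ne_zero _ ht0) (gard0 hpe hl hx _ (Or.inr ?_))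
    rw [Complex.div_re]
    simp
    exact div_nonneg ht (Complex.normSq_nonneg _)

lemma gard_T {P : MvPolynomial (Fin m) ℝ} {e : EuclideanSpace ℝ (Fin m)}
    {lm : EuclideanSpace ℝ (Fin m) → Fin d → ℝ} (h : P.IsHomogeneous d) (hpe : pfun P e ≠ 0)
    (hl : ∀ (x : EuclideanSpace ℝ (Fin m)) (t : ℝ),
      pfun P (x + t • e) = pfun P e * ∏ i, (lm x i + t))
    {x : EuclideanSpace ℝ (Fin m)} (hx : x ∈ K0 P e) (y : EuclideanSpace ℝ (Fin m)) (b : ℝ)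
    (hb : 0 ≤ b) :
    pcx P (cst y + Complex.I • (cst (e + b • x))) ≠ 0 := by
  have := homotopy h (Complex.I • cst e) (cst y) (cst x) ?_ ?_ (gard_start h hpe hl hx)
    (Complex.I * b) (by simpa using hb)
  · convert this using 2
    rw [cst_add, cst_smul, smul_add, smul_smul]
    abel
  · rw [pcx_cst]
    have := hx 0 le_rfl
    simp at this
    exact_mod_cast this
  · intro τ hτ t h0
    have e1 : Complex.I • cst e + (τ:ℂ) • cst y + (t:ℂ) • cst x =
        cst (τ • y + t • x) + Complex.I • cst e := by
      rw [cst_add, cst_smul, cst_smul]; abel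
    rw [e1, pcx_line hl] at h0
    have hpe' : (pfun P e : ℂ) ≠ 0 := by exact_mod_cast hpe
    obtain ⟨i, -, hi⟩ := Finset.prod_eq_zero_iff.mp ((mul_eq_zero.mp h0).resolve_left hpe')
    have h2 := congrArg Complex.im hi
    simp at h2

lemma K0_sub {P : MvPolynomial (Fin m) ℝ} {e : EuclideanSpace ℝ (Fin m)}
    {lm : EuclideanSpace ℝ (Fin m) → Fin d → ℝ} (hpe : pfun P e ≠ 0)
    (hl : ∀ (x : EuclideanSpace ℝ (Fin m)) (t : ℝ),
      pfun P (x + t • e) = pfun P e * ∏ i, (lm x i + t))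
    {x : EuclideanSpace ℝ (Fin m)} : x ∈ K0 P e ↔ ∀ i, 0 < lm x i := by
  constructor
  · intro hx i
    by_contra hc
    push Not at hc
    apply hx (- lm x i) (by linarith)
    rw [hl]
    apply mul_eq_zero_of_right
    exact Finset.prod_eq_zero (Finset.mem_univ i) (by ring)
  · intro hx s hs
    rw [hl]
    refine mul_ne_zero hpe (Finset.prod_ne_zero_iff.mpr fun i _ => ?_)
    have := hx i
    positivity

lemma K0_smul {P : MvPolynomial (Fin m) ℝ} {e : EuclideanSpace ℝ (Fin m)}
    (h : P.IsHomogeneous d) {x : EuclideanSpace ℝ (Fin m)} (hx : x ∈ K0 P e) {c : ℝ} (hc : 0 < c) :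
    c • x ∈ K0 P e := by
  intro s hs
  have : c • x + s • e = c • (x + (s / c) • e) := by
    rw [smul_add, smul_smul, mul_div_cancel₀ _ hc.ne']
  rw [this, pfun_hom h]
  exact mul_ne_zero (pow_ne_zero _ hc.ne') (hx _ (by positivity))

lemma K0_shift {P : MvPolynomial (Fin m) ℝ} {e : EuclideanSpace ℝ (Fin m)}
    {lm : EuclideanSpace ℝ (Fin m) → Fin d → ℝ} (hpe : pfun P e ≠ 0)
    (hl : ∀ (x : EuclideanSpace ℝ (Fin m)) (t : ℝ),
      pfun P (x + t • e) = pfun P e * ∏ i, (lm x i + t))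
    {x : EuclideanSpace ℝ (Fin m)} {c : ℝ} : x + c • e ∈ K0 P e ↔ ∀ i, 0 < lm x i + c := by
  have hs : ∀ s : ℝ, pfun P (x + c • e + s • e) = pfun P e * ∏ i, (lm x i + c + s) := by
    intro s
    rw [add_assoc, ← add_smul, hl]
    simp [add_assoc]
  constructor
  · intro hx i
    by_contra hc
    push Not at hc
    apply hx (- (lm x i + c)) (by linarith)
    rw [hs]
    apply mul_eq_zero_of_right
    exact Finset.prod_eq_zero (Finset.mem_univ i) (by ring)
  · intro hx s hs'
    rw [hs]
    refine mul_ne_zero hpe (Finset.prod_ne_zero_iff.mpr fun i _ => ?_)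
    have := hx i
    positivity

lemma exists_lt_all {n : ℕ} (f : Fin n → ℝ) (hf : ∀ i, 0 < f i) : ∃ ε > 0, ∀ i, ε < f i := by
  have : ∀ᶠ ε in nhdsWithin (0:ℝ) (Set.Ioi 0), ∀ i, ε < f i := by
    rw [Filter.eventually_all]
    intro i
    filter_upwards [Ioo_mem_nhdsGT (hf i)] with ε hε using hε.2
  obtain ⟨ε, h1, h2⟩ := (this.and self_mem_nhdsWithin).exists
  exact ⟨ε, h2, h1⟩

lemma gard_T' {P : MvPolynomial (Fin m) ℝ} {e : EuclideanSpace ℝ (Fin m)}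
    {lm : EuclideanSpace ℝ (Fin m) → Fin d → ℝ} (h : P.IsHomogeneous d) (hpe : pfun P e ≠ 0)
    (hl : ∀ (x : EuclideanSpace ℝ (Fin m)) (t : ℝ),
      pfun P (x + t • e) = pfun P e * ∏ i, (lm x i + t))
    {x : EuclideanSpace ℝ (Fin m)} (hx : x ∈ K0 P e) (y : EuclideanSpace ℝ (Fin m)) (b : ℝ)
    (hb : b ≠ 0) :
    pcx P (cst y + (Complex.I * b) • cst x) ≠ 0 := by
  obtain ⟨ε, hε, hlt⟩ := exists_lt_all _ ((K0_sub hpe hl).mp hx)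
  have hx' : x + (-ε) • e ∈ K0 P e :=
    (K0_shift hpe hl).mpr fun i => by linarith [hlt i]
  have := gard_T h hpe hl hx' ((ε * b)⁻¹ • y) ε⁻¹ (by positivity)
  have e2 : e + ε⁻¹ • (x + (-ε) • e) = ε⁻¹ • x := by
    rw [smul_add, smul_smul]
    have : ε⁻¹ * -ε = -1 := by field_simp
    rw [this]; simp
  rw [e2] at this
  have hεc : (ε:ℂ) ≠ 0 := by exact_mod_cast hε.ne'
  have hbc : (b:ℂ) ≠ 0 := by exact_mod_cast hb
  have e3 : cst y + (Complex.I * b) • cst x =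
     ((ε * b : ℝ) : ℂ) • (cst (((ε * b)⁻¹ • y)) + Complex.I • cst (ε⁻¹ • x)) := by
    simp only [cst_smul]
    ext i
    simp
    field_simp
  rw [e3, pcx_hom h]
  refine mul_ne_zero (pow_ne_zero _ ?_) this
  exact_mod_cast mul_ne_zero hε.ne' hb

lemma K0_add {P : MvPolynomial (Fin m) ℝ} {e : EuclideanSpace ℝ (Fin m)}
    {lm : EuclideanSpace ℝ (Fin m) → Fin d → ℝ} (h : P.IsHomogeneous d) (hpe : pfun P e ≠ 0)
    (hl : ∀ (x : EuclideanSpace ℝ (Fin m)) (t : ℝ),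
      pfun P (x + t • e) = pfun P e * ∏ i, (lm x i + t))
    {x z : EuclideanSpace ℝ (Fin m)} (hx : x ∈ K0 P e) (hz : z ∈ K0 P e) : x + z ∈ K0 P e := by
  have main : ∀ x ∈ K0 P e, pfun P (x + z) ≠ 0 := by
    intro x hx
    have hI : (-Complex.I) ≠ 0 := by simp
    have := homotopy h (cst e) (cst (x - e)) ((-Complex.I) • cst z) ?_ ?_ ?_ Complex.I (by simp)
    · rw [← cst_add, add_sub_cancel, smul_smul] at this
      simp only [mul_neg, Complex.I_mul_I, neg_neg, one_smul] at this
      rw [← cst_add, pcx_cst] at this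
      exact_mod_cast this
    · rw [pcx_hom h, pcx_cst]
      refine mul_ne_zero (pow_ne_zero _ hI) ?_
      have := hz 0 le_rfl
      simp at this
      exact_mod_cast this
    · intro τ hτ t
      rw [← cst_smul, ← cst_add]
      by_cases ht : t = 0
      · subst ht
        simp only [Complex.ofReal_zero, zero_smul, add_zero]
        rw [pcx_cst]
        have e1 : e + τ • (x - e) = τ • x + (1 - τ) • e := by module
        rw [e1]
        rcases hτ.1.lt_or_eq with h' | h'
        · exact_mod_cast K0_smul h hx h' _ (by linarith [hτ.2])
        · subst h'; simpa using hpe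
      · have := gard_T' h hpe hl hz (e + τ • (x - e)) (-t) (by simpa using ht)
        rw [smul_smul]
        convert this using 4
        push_cast; ring
    · intro t ht
      have e1 : cst e + t • (-Complex.I) • cst z = (-Complex.I) • (Complex.I • cst e + t • cst z) := by
        rw [smul_add, smul_smul, smul_smul, smul_smul]
        simp [mul_comm]
      rw [e1, pcx_hom h]
      exact mul_ne_zero (pow_ne_zero _ hI) (gard_start h hpe hl hz t ht)
  intro s hs
  have : x + z + s • e = (x + s • e) + z := by abel
  rw [this]
  apply main
  intro s' hs'
  rw [add_assoc, ← add_smul]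
  exact hx _ (by positivity)

lemma K_iff {P : MvPolynomial (Fin m) ℝ} {e : EuclideanSpace ℝ (Fin m)}
    {lm : EuclideanSpace ℝ (Fin m) → Fin d → ℝ} (hpe : pfun P e ≠ 0)
    (hl : ∀ (x : EuclideanSpace ℝ (Fin m)) (t : ℝ),
      pfun P (x + t • e) = pfun P e * ∏ i, (lm x i + t))
    {x : EuclideanSpace ℝ (Fin m)} : (∀ i, 0 ≤ lm x i) ↔ ∀ ε : ℝ, 0 < ε → x + ε • e ∈ K0 P e := by
  simp only [K0_shift hpe hl]
  constructor
  · intro hx ε hε i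
    linarith [hx i]
  · intro hx i
    refine le_of_forall_pos_lt_add fun ε hε => hx ε hε i

lemma K_add {P : MvPolynomial (Fin m) ℝ} {e : EuclideanSpace ℝ (Fin m)}
    {lm : EuclideanSpace ℝ (Fin m) → Fin d → ℝ} (h : P.IsHomogeneous d) (hpe : pfun P e ≠ 0)
    (hl : ∀ (x : EuclideanSpace ℝ (Fin m)) (t : ℝ),
      pfun P (x + t • e) = pfun P e * ∏ i, (lm x i + t))
    {x z : EuclideanSpace ℝ (Fin m)} (hx : ∀ i, 0 ≤ lm x i) (hz : ∀ i, 0 ≤ lm z i) :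
    ∀ i, 0 ≤ lm (x + z) i := by
  rw [K_iff hpe hl] at *
  intro ε hε
  have := K0_add h hpe hl (hx (ε/2) (by positivity)) (hz (ε/2) (by positivity))
  convert this using 1
  module

lemma K_smul {P : MvPolynomial (Fin m) ℝ} {e : EuclideanSpace ℝ (Fin m)}
    {lm : EuclideanSpace ℝ (Fin m) → Fin d → ℝ} (h : P.IsHomogeneous d) (hpe : pfun P e ≠ 0)
    (hl : ∀ (x : EuclideanSpace ℝ (Fin m)) (t : ℝ),
      pfun P (x + t • e) = pfun P e * ∏ i, (lm x i + t))
    {x : EuclideanSpace ℝ (Fin m)} (hx : ∀ i, 0 ≤ lm x i) {c : ℝ} (hc : 0 < c) :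
    ∀ i, 0 ≤ lm (c • x) i := by
  rw [K_iff hpe hl] at *
  intro ε hε
  have := K0_smul h (hx (ε/c) (by positivity)) hc
  convert this using 1
  rw [smul_add, smul_smul, mul_div_cancel₀ _ hc.ne']

lemma pfun_smooth (P : MvPolynomial (Fin m) ℝ) : ContDiff ℝ (⊤ : ℕ∞) (pfun P) := by
  unfold pfun
  induction P using MvPolynomial.induction_on with
  | C a => simpa using contDiff_const
  | add p q hp hq => simpa using hp.add hq
  | mul_X p i hp =>
    simp only [map_mul, MvPolynomial.eval_X]
    refine hp.mul ?_
    fun_prop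

lemma dir_smooth (e : EuclideanSpace ℝ (Fin m)) (P : MvPolynomial (Fin m) ℝ) (k : ℕ) :
    ContDiff ℝ (⊤ : ℕ∞) ((dirDeriv e)^[k] (pfun P)) := by
  induction k with
  | zero => exact pfun_smooth P
  | succ k ih =>
    rw [Function.iterate_succ_apply']
    unfold dirDeriv
    exact (ih.fderiv_right (m := ((⊤ : ℕ∞) : WithTop ℕ∞)) (by simp)).clm_apply contDiff_const

noncomputable def Bp (pe : ℝ) (l : Fin d → ℝ) : Polynomial ℝ :=
  Polynomial.C pe * ∏ i, (Polynomial.X + Polynomial.C (l i))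

lemma dir_eval {P : MvPolynomial (Fin m) ℝ} {e : EuclideanSpace ℝ (Fin m)}
    {lm : EuclideanSpace ℝ (Fin m) → Fin d → ℝ}
    (hl : ∀ (x : EuclideanSpace ℝ (Fin m)) (t : ℝ),
      pfun P (x + t • e) = pfun P e * ∏ i, (lm x i + t)) (x : EuclideanSpace ℝ (Fin m)) (k : ℕ) :
    ∀ s : ℝ, (dirDeriv e)^[k] (pfun P) (x + s • e) =
      (Polynomial.derivative^[k] (Bp (pfun P e) (lm x))).eval s := by
  induction k with
  | zero =>
    intro s
    simp only [Function.iterate_zero, id_eq, Bp]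
    rw [hl]
    simp [Polynomial.eval_prod, add_comm]
  | succ k ih =>
    intro s
    rw [Function.iterate_succ_apply', Function.iterate_succ_apply']
    have hd : DifferentiableAt ℝ ((dirDeriv e)^[k] (pfun P)) (x + s • e) :=
      ((dir_smooth e P k).differentiable (by simp)).differentiableAt
    have h1 : HasDerivAt (fun s : ℝ => x + s • e) e s := by
      simpa using ((hasDerivAt_id s).smul_const e).const_add x
    have h2 := hd.hasFDerivAt.comp_hasDerivAt s h1
    have h3 := (Polynomial.derivative^[k] (Bp (pfun P e) (lm x))).hasDerivAt s
    have : ((dirDeriv e)^[k] (pfun P)) ∘ (fun s : ℝ => x + s • e) =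
      fun s => (Polynomial.derivative^[k] (Bp (pfun P e) (lm x))).eval s := funext ih
    rw [this] at h2
    exact h2.unique h3

lemma dir_eval0 {P : MvPolynomial (Fin m) ℝ} {e : EuclideanSpace ℝ (Fin m)}
    {lm : EuclideanSpace ℝ (Fin m) → Fin d → ℝ}
    (hl : ∀ (x : EuclideanSpace ℝ (Fin m)) (t : ℝ),
      pfun P (x + t • e) = pfun P e * ∏ i, (lm x i + t)) (x : EuclideanSpace ℝ (Fin m)) (k : ℕ) :
    (dirDeriv e)^[k] (pfun P) x =
      (k.factorial : ℝ) * (pfun P e * (∏ i, (Polynomial.X + Polynomial.C (lm x i))).coeff k) := by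
  have := dir_eval hl x k 0
  rw [zero_smul, add_zero, ← Polynomial.coeff_zero_eq_eval_zero,
    Polynomial.coeff_iterate_derivative] at this
  rw [this, zero_add, Nat.descFactorial_self, nsmul_eq_mul, Bp, Polynomial.coeff_C_mul]

lemma coeff_nn (l : Fin d → ℝ) (hl : ∀ i, 0 ≤ l i) (k : ℕ) :
    0 ≤ (∏ i, (Polynomial.X + Polynomial.C (l i))).coeff k := by
  revert k
  refine Finset.prod_induction _ (fun p : Polynomial ℝ => ∀ k, 0 ≤ p.coeff k) ?_ ?_ ?_
  · intro a b ha hb k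
    rw [Polynomial.coeff_mul]
    exact Finset.sum_nonneg fun i _ => mul_nonneg (ha _) (hb _)
  · intro k
    rw [Polynomial.coeff_one]; split_ifs <;> simp
  · intro i _ k
    rw [Polynomial.coeff_add, Polynomial.coeff_X, Polynomial.coeff_C]
    have := hl i
    split_ifs <;> simp [this]; linarith

lemma prod_fac (l : Fin d → ℝ) :
    ∏ i, (Polynomial.X + Polynomial.C (l i)) =
      Polynomial.X ^ (Finset.univ.filter fun i => l i = 0).card *
      ∏ i ∈ Finset.univ.filter (fun i => ¬ l i = 0), (Polynomial.X + Polynomial.C (l i)) := by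
  rw [← Finset.prod_filter_mul_prod_filter_not Finset.univ (fun i => l i = 0)]
  congr 1
  rw [Finset.prod_congr rfl (g := fun _ => Polynomial.X), Finset.prod_const]
  intro i hi
  simp [(Finset.mem_filter.mp hi).2]

lemma coeff_r (l : Fin d → ℝ) (hl : ∀ i, 0 ≤ l i) :
    0 < (∏ i, (Polynomial.X + Polynomial.C (l i))).coeff
      (Finset.univ.filter fun i => l i = 0).card := by
  rw [prod_fac, Polynomial.coeff_X_pow_mul', if_pos le_rfl, Nat.sub_self,
    Polynomial.coeff_zero_eq_eval_zero, Polynomial.eval_prod]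
  refine Finset.prod_pos fun i hi => ?_
  simpa using lt_of_le_of_ne (hl i) (Ne.symm (Finset.mem_filter.mp hi).2)

lemma coeff_lt (l : Fin d → ℝ) (k : ℕ) (hk : k < (Finset.univ.filter fun i => l i = 0).card) :
    (∏ i, (Polynomial.X + Polynomial.C (l i))).coeff k = 0 := by
  rw [prod_fac, Polynomial.coeff_X_pow_mul', if_neg (by omega)]

lemma deriv_nn {h : ℝ → ℝ} {h' : ℝ} (hd : HasDerivAt h h' 0) (h0 : h 0 = 0)
    (hp : ∀ u ∈ Set.Ioo (0:ℝ) 1, 0 ≤ h u) : 0 ≤ h' := by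
  have := (hasDerivAt_iff_tendsto_slope.mp hd).mono_left
    (nhdsWithin_mono 0 (fun u (hu : u ∈ Set.Ioi (0:ℝ)) => ne_of_gt hu))
  refine ge_of_tendsto this ?_
  filter_upwards [Ioo_mem_nhdsGT (zero_lt_one' ℝ)] with u hu
  rw [slope_def_field, h0, sub_zero, sub_zero]
  exact div_nonneg (hp u hu) hu.1.le

lemma topt_spec {P : MvPolynomial (Fin m) ℝ} {e : EuclideanSpace ℝ (Fin m)}
    {lm : EuclideanSpace ℝ (Fin m) → Fin d → ℝ} (hpe : pfun P e ≠ 0)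
    (hl : ∀ (x : EuclideanSpace ℝ (Fin m)) (t : ℝ),
      pfun P (x + t • e) = pfun P e * ∏ i, (lm x i + t)) (w : EuclideanSpace ℝ (Fin m))
    (t : ℝ) : (∀ i, 0 ≤ lm (w - t • e) i) ↔ ∀ i, t ≤ lm w i := by
  rw [K_iff hpe hl]
  have : ∀ ε : ℝ, w - t • e + ε • e = w + (ε - t) • e := fun ε => by module
  simp only [this, K0_shift hpe hl]
  constructor
  · intro hx i
    refine le_of_forall_pos_lt_add fun ε hε => by linarith [hx ε hε i]
  · intro hx ε hε i
    linarith [hx i]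

end helpers

/-- Let `K = Λ(p,e) ⊆ ℝ^m` be a regular hyperbolicity cone,
`c_D > 0`, `w ∈ ℝ^m`, `t_opt = min(0, λ_min(w))` and `z_opt = w - t_opt e`.
If `t_opt < 0` then, with `r = mult(z_opt)`, we have `⟨e, ∇p^{(r-1)}(z_opt)⟩ ≠ 0` and
`(c_D / ⟨e, ∇p^{(r-1)}(z_opt)⟩) ∇p^{(r-1)}(z_opt)` is an optimal solution of
`min {⟨w,s⟩ : s ∈ K*, ⟨e,s⟩ ≤ c_D}`. -/
theorem stmt_14 {m d : ℕ}
    (P : MvPolynomial (Fin m) ℝ) (e : EuclideanSpace ℝ (Fin m))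
    (lm : EuclideanSpace ℝ (Fin m) → Fin d → ℝ)
    (hhom : P.IsHomogeneous d)
    (hpe : pfun P e ≠ 0)
    (hroots : ∀ (x : EuclideanSpace ℝ (Fin m)) (t : ℝ),
      pfun P (x - t • e) = pfun P e * ∏ i, (lm x i - t))
    (hord : ∀ x, Antitone (lm x))
    (K : Set (EuclideanSpace ℝ (Fin m)))
    (hKdef : K = {x : EuclideanSpace ℝ (Fin m) | ∀ i, 0 ≤ lm x i})
    (hpointed : K ∩ (-K) = {0}) (hfull : (interior K).Nonempty)
    (he : e ∈ interior K)
    (cD : ℝ) (hcD : 0 < cD) (w : EuclideanSpace ℝ (Fin m))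
    (topt : ℝ) (htopt : topt = min 0 (sSup {t : ℝ | w - t • e ∈ K}))
    (hneg : topt < 0)
    (zopt : EuclideanSpace ℝ (Fin m)) (hzopt : zopt = w - topt • e)
    (r : ℕ) (hr : r = (Finset.univ.filter fun i => lm zopt i = 0).card)
    (gv : EuclideanSpace ℝ (Fin m))
    (hgv : gv = gradient ((dirDeriv e)^[r - 1] (pfun P)) zopt) :
    ⟪e, gv⟫ ≠ 0 ∧
    (∀ x ∈ K, 0 ≤ ⟪x, (cD / ⟪e, gv⟫) • gv⟫) ∧
    ⟪e, (cD / ⟪e, gv⟫) • gv⟫ ≤ cD ∧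
    ∀ s : EuclideanSpace ℝ (Fin m), (∀ x ∈ K, 0 ≤ ⟪x, s⟫) → ⟪e, s⟫ ≤ cD →
      ⟪w, (cD / ⟪e, gv⟫) • gv⟫ ≤ ⟪w, s⟫ := by
  have hl : ∀ (x : EuclideanSpace ℝ (Fin m)) (t : ℝ),
      pfun P (x + t • e) = pfun P e * ∏ i, (lm x i + t) := by
    intro x t
    have := hroots x (-t)
    simpa using this
  have hset : {t : ℝ | w - t • e ∈ K} = {t : ℝ | ∀ i, t ≤ lm w i} := by
    ext t
    simp only [hKdef, Set.mem_ofPred_eq]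
    exact topt_spec hpe hl w t
  rw [hset] at htopt
  have htS : topt = sSup {t : ℝ | ∀ i, t ≤ lm w i} := by
    rcases min_choice 0 (sSup {t : ℝ | ∀ i, t ≤ lm w i}) with h | h
    · rw [h] at htopt; linarith
    · rw [h] at htopt; exact htopt
  have hdpos : Nonempty (Fin d) := by
    by_contra hcon
    rw [not_nonempty_iff] at hcon
    have : {t : ℝ | ∀ i, t ≤ lm w i} = Set.univ := by ext t; simp
    rw [this, Real.sSup_univ] at htS
    linarith
  obtain ⟨i₀, hi₀⟩ := Finite.exists_min (lm w)
  have hlub : IsGreatest {t : ℝ | ∀ i, t ≤ lm w i} (lm w i₀) :=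
    ⟨hi₀, fun t ht => ht i₀⟩
  rw [hlub.csSup_eq] at htS
  have hzK : ∀ i, 0 ≤ lm zopt i := by
    rw [hzopt, topt_spec hpe hl, htS]; exact hi₀
  have hz0 : pfun P zopt = 0 := by
    rw [hzopt, hroots]
    apply mul_eq_zero_of_right
    exact Finset.prod_eq_zero (Finset.mem_univ i₀) (by rw [htS]; ring)
  have hrpos : 0 < r := by
    have h1 := hl zopt 0
    rw [zero_smul, add_zero, hz0] at h1
    obtain ⟨i, -, hi⟩ := Finset.prod_eq_zero_iff.mp ((mul_eq_zero.mp h1.symm).resolve_left hpe)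
    rw [hr]
    exact Finset.card_pos.mpr ⟨i, by simpa using hi⟩
  set q := (dirDeriv e)^[r - 1] (pfun P) with hq
  have hqd : DifferentiableAt ℝ q zopt :=
    ((dir_smooth e P (r-1)).differentiable (by simp)).differentiableAt
  have hin : ∀ x, ⟪x, gv⟫ = fderiv ℝ q zopt x := by
    intro x
    rw [hgv, real_inner_comm, gradient, InnerProductSpace.toDual_symm_apply]
  have hqz : q zopt = 0 := by
    rw [hq, dir_eval0 hl, coeff_lt _ _ (by omega)]; ring
  have hege : ⟪e, gv⟫ = (dirDeriv e)^[r] (pfun P) zopt := by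
    rw [hin]
    obtain ⟨k, rfl⟩ : ∃ k, r = k + 1 := ⟨r - 1, by omega⟩
    rw [Function.iterate_succ_apply']
    rfl
  have hepos : 0 < pfun P e * ⟪e, gv⟫ := by
    rw [hege, dir_eval0 hl]
    have h1 := coeff_r (lm zopt) hzK
    rw [← hr] at h1
    have h2 : 0 < pfun P e * pfun P e := mul_self_pos.mpr hpe
    have h3 : (0:ℝ) < r.factorial := by exact_mod_cast r.factorial_pos
    have := mul_pos h3 (mul_pos h2 h1)
    linarith
  have hdir : ∀ x, (∀ u ∈ Set.Ioo (0:ℝ) 1, ∀ i, 0 ≤ lm (zopt + u • x) i) →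
      0 ≤ pfun P e * ⟪x, gv⟫ := by
    intro x hx
    have h1 : HasDerivAt (fun s : ℝ => zopt + s • x) x 0 := by
      simpa using ((hasDerivAt_id (0:ℝ)).smul_const x).const_add zopt
    have hqd' : HasFDerivAt q (fderiv ℝ q zopt) (zopt + (0:ℝ) • x) := by
      simpa using hqd.hasFDerivAt
    have h2 := (hqd'.comp_hasDerivAt (0:ℝ) h1).const_mul (pfun P e)
    rw [← hin] at h2
    refine deriv_nn h2 (by simp [hqz]) ?_
    intro u hu
    simp only [Function.comp_apply]
    rw [hq, dir_eval0 hl]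
    have h4 := coeff_nn _ (hx u hu) (r-1)
    have h5 := mul_self_nonneg (pfun P e)
    have h3 : (0:ℝ) ≤ (r-1).factorial := by positivity
    have := mul_nonneg h3 (mul_nonneg h5 h4)
    linarith
  have hKd : ∀ x ∈ K, 0 ≤ pfun P e * ⟪x, gv⟫ := by
    intro x hx
    rw [hKdef] at hx
    exact hdir x fun u hu => K_add hhom hpe hl hzK (K_smul hhom hpe hl hx hu.1)
  have hzz : ⟪zopt, gv⟫ = 0 := by
    have h1 := hKd zopt (by rw [hKdef]; exact hzK)
    have h2 := hdir (-zopt) (by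
      intro u hu
      have : zopt + u • (-zopt) = (1 - u) • zopt := by module
      rw [this]
      exact K_smul hhom hpe hl hzK (by linarith [hu.2]))
    rw [inner_neg_left] at h2
    have : pfun P e * ⟪zopt, gv⟫ = 0 := by linarith
    exact (mul_eq_zero.mp this).resolve_left hpe
  have hne : ⟪e, gv⟫ ≠ 0 := by
    intro h; rw [h] at hepos; simp at hepos
  have hes : ⟪e, (cD / ⟪e, gv⟫) • gv⟫ = cD := by
    rw [real_inner_smul_right, div_mul_cancel₀ _ hne]
  refine ⟨hne, ?_, hes.le, ?_⟩
  · intro x hx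
    rw [real_inner_smul_right]
    have e1 : cD / ⟪e, gv⟫ * ⟪x, gv⟫ = cD * (pfun P e * ⟪x, gv⟫) / (pfun P e * ⟪e, gv⟫) := by
      field_simp
    rw [e1]
    exact div_nonneg (mul_nonneg hcD.le (hKd x hx)) hepos.le
  · intro s hs hes'
    have hw : w = zopt + topt • e := by rw [hzopt]; abel
    have h1 := hs zopt (by rw [hKdef]; exact hzK)
    rw [hw, inner_add_left, inner_add_left, real_inner_smul_left, real_inner_smul_left, hes,
      real_inner_smul_right, hzz]
    nlinarith
end

section
/- Let f : ℝ^n → ℝ be μ-strongly convex, T : ℝ^n → ℝ^m linear, b ∈ ℝ^m, K ⊆ ℝ^m a regular closed convex cone; suppose the primal problem min{f(x) : Tx + b ∈ K} satisfies Slater's condition (there exists x̄ with T x̄ + b ∈ int K), so it has a unique optimal solution x_opt. Let e ∈ int K and c_D > 0 be such that some optimal solution y of the dual min{f*(T*y) + ⟨b,y⟩ : y ∈ K*} satisfies ⟨e, y⟩ ≤ c_D. If {y_k} is any sequence with y_k ∈ K*, ⟨e, y_k⟩ ≤ c_D for all k, and f*(T*y_k) + ⟨b, y_k⟩ → d* (the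 dual optimal value), then the sequence x_k := ∇f*(T* y_k) converges to x_opt. -/
open scoped RealInnerProductSpace

/-- The dual objective `h(y) = f*(T*y) + ⟨b,y⟩`. -/
noncomputable def dualObj {n m : ℕ} (f : EuclideanSpace ℝ (Fin n) → ℝ)
    (T : EuclideanSpace ℝ (Fin n) →L[ℝ] EuclideanSpace ℝ (Fin m))
    (b y : EuclideanSpace ℝ (Fin m)) : ℝ :=
  fenchelConj f (ContinuousLinearMap.adjoint T y) + ⟪b, y⟫

lemma aux_ex {n : ℕ} (μ : ℝ) (hμ : 0 < μ)
    (f : EuclideanSpace ℝ (Fin n) → ℝ)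
    (hf : ∀ x y : EuclideanSpace ℝ (Fin n), ∀ θ : ℝ, 0 ≤ θ → θ ≤ 1 →
      f (θ • x + (1 - θ) • y)
        ≤ θ * f x + (1 - θ) * f y - μ / 2 * θ * (1 - θ) * ‖x - y‖ ^ 2)
    (s : EuclideanSpace ℝ (Fin n)) :
    ∃ z, ∀ x, f z - ⟪s, z⟫ ≤ f x - ⟪s, x⟫ := by
  have hcf : ConvexOn ℝ Set.univ f := by
    refine ⟨convex_univ, ?_⟩
    intro x _ y _ a b ha hb hab
    have h := hf x y a ha (by linarith)
    have hb' : 1 - a = b := by linarith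
    rw [hb'] at h
    have : 0 ≤ μ / 2 * a * b * ‖x - y‖ ^ 2 := by positivity
    simp only [smul_eq_mul]
    linarith
  have hcont : Continuous f := by
    have := hcf.continuousOn isOpen_univ
    exact continuousOn_univ.mp this
  set g : EuclideanSpace ℝ (Fin n) → ℝ := fun x => f x - ⟪s, x⟫ with hg
  have hgc : Continuous g := by fun_prop
  obtain ⟨w, hw, hwm⟩ := (isCompact_closedBall (0 : EuclideanSpace ℝ (Fin n)) 1).exists_isMinOn
    ⟨0, by simp⟩ hgc.continuousOn
  have hw0 : g w ≤ g 0 := hwm (by simp)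
  set R := 1 + 2 * (g 0 - g w) / μ with hR
  have hR1 : 1 ≤ R := by
    have : 0 ≤ 2 * (g 0 - g w) / μ := div_nonneg (by linarith) hμ.le
    linarith
  obtain ⟨z, hz, hzm⟩ := (isCompact_closedBall (0 : EuclideanSpace ℝ (Fin n)) R).exists_isMinOn
    ⟨0, by simp; linarith⟩ hgc.continuousOn
  refine ⟨z, fun x => ?_⟩
  change g z ≤ g x
  by_cases hx : ‖x‖ ≤ R
  · exact hzm (by simpa using hx)
  push Not at hx
  have hz0 : g z ≤ g 0 := hzm (by simp; linarith)
  have hxp : 0 < ‖x‖ := by linarith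
  have h1 := hf x 0 (‖x‖⁻¹) (by positivity) (inv_le_one_of_one_le₀ (by linarith))
  have h2 : g w ≤ g (‖x‖⁻¹ • x) := hwm (by simp [norm_smul, hxp.ne'])
  simp only [smul_zero, add_zero, sub_zero] at h1
  have h3 : g (‖x‖⁻¹ • x) = f (‖x‖⁻¹ • x) - ‖x‖⁻¹ * ⟪s, x⟫ := by
    simp [hg, inner_smul_right]
  have h4 : g 0 = f 0 := by simp [hg]
  have h5 : g w ≤ ‖x‖⁻¹ * g x + (1 - ‖x‖⁻¹) * g 0 - μ / 2 * ‖x‖⁻¹ * (1 - ‖x‖⁻¹) * ‖x‖ ^ 2 := by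
    rw [h4]; simp only [hg] at h2 h3 ⊢; linarith
  have h6 : μ / 2 * ‖x‖⁻¹ * (1 - ‖x‖⁻¹) * ‖x‖ ^ 2 = μ / 2 * (‖x‖ - 1) := by
    field_simp
  have h7 : g 0 - g w < μ / 2 * (‖x‖ - 1) := by
    have : 2 * (g 0 - g w) / μ < ‖x‖ - 1 := by linarith
    rw [div_lt_iff₀ hμ] at this
    linarith
  have h8 : 0 < ‖x‖⁻¹ * (g x - g 0) := by rw [h6] at h5; linarith
  have := (mul_pos_iff_of_pos_left (inv_pos.mpr hxp)).mp h8
  linarith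

lemma aux_quad (a c : ℝ) (h : ∀ t : ℝ, 0 < t → t ≤ 1 → 0 ≤ t * a + t ^ 2 * c) : 0 ≤ a := by
  by_contra ha
  push Not at ha
  have hp : 0 < |c| + 1 - a := by have := abs_nonneg c; linarith
  have h1 := h (-a / (|c| + 1 - a)) (div_pos (by linarith) hp)
    ((div_le_one hp).mpr (by have := abs_nonneg c; linarith))
  set t := -a / (|c| + 1 - a) with ht
  have htp : 0 < t := div_pos (by linarith) hp
  have h2 : t * (|c| + 1 - a) = -a := by rw [ht]; field_simp
  have h3 : 0 ≤ t * (a + t * c) := by linarith [h1, sq t]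
  have h4 := (mul_nonneg_iff_of_pos_left htp).mp h3
  have h5 : t * c ≤ t * |c| := mul_le_mul_of_nonneg_left (le_abs_self c) htp.le
  nlinarith

lemma aux_strong {n : ℕ} (μ : ℝ)
    (f : EuclideanSpace ℝ (Fin n) → ℝ)
    (hf : ∀ x y : EuclideanSpace ℝ (Fin n), ∀ θ : ℝ, 0 ≤ θ → θ ≤ 1 →
      f (θ • x + (1 - θ) • y)
        ≤ θ * f x + (1 - θ) * f y - μ / 2 * θ * (1 - θ) * ‖x - y‖ ^ 2)
    (s z : EuclideanSpace ℝ (Fin n)) (hz : ∀ x, f z - ⟪s, z⟫ ≤ f x - ⟪s, x⟫)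
    (x : EuclideanSpace ℝ (Fin n)) :
    f z - ⟪s, z⟫ + μ / 2 * ‖x - z‖ ^ 2 ≤ f x - ⟪s, x⟫ := by
  have := aux_quad (f x - ⟪s, x⟫ - (f z - ⟪s, z⟫) - μ / 2 * ‖x - z‖ ^ 2) (μ / 2 * ‖x - z‖ ^ 2) ?_
  · linarith
  intro t h0 h1
  have h2 := hf x z t h0.le h1
  have h3 := hz (t • x + (1 - t) • z)
  simp only [inner_add_right, inner_smul_right] at h3
  nlinarith

lemma aux_conj {n : ℕ} 
    (f : EuclideanSpace ℝ (Fin n) → ℝ)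
    (s z : EuclideanSpace ℝ (Fin n)) (hz : ∀ x, f z - ⟪s, z⟫ ≤ f x - ⟪s, x⟫) :
    fenchelConj f s = ⟪s, z⟫ - f z := by
  unfold fenchelConj
  apply le_antisymm
  · exact ciSup_le fun x => by linarith [hz x]
  · exact le_ciSup (f := fun x => ⟪s, x⟫ - f x)
      ⟨⟪s, z⟫ - f z, by rintro _ ⟨x, rfl⟩; show ⟪s, x⟫ - f x ≤ _; linarith [hz x]⟩ z

lemma aux_upper {n : ℕ} (μ : ℝ) (hμ : 0 < μ)
    (f : EuclideanSpace ℝ (Fin n) → ℝ)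
    (hf : ∀ x y : EuclideanSpace ℝ (Fin n), ∀ θ : ℝ, 0 ≤ θ → θ ≤ 1 →
      f (θ • x + (1 - θ) • y)
        ≤ θ * f x + (1 - θ) * f y - μ / 2 * θ * (1 - θ) * ‖x - y‖ ^ 2)
    (s z : EuclideanSpace ℝ (Fin n)) (hz : ∀ x, f z - ⟪s, z⟫ ≤ f x - ⟪s, x⟫)
    (d : EuclideanSpace ℝ (Fin n)) :
    fenchelConj f (s + d) ≤ fenchelConj f s + ⟪d, z⟫ + ‖d‖ ^ 2 * (1 / (2 * μ)) := by
  rw [aux_conj f s z hz]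
  unfold fenchelConj
  refine ciSup_le fun x => ?_
  have h1 := aux_strong μ f hf s z hz x
  have h2 : ⟪d, x - z⟫ ≤ ‖d‖ * ‖x - z‖ := real_inner_le_norm _ _
  rw [inner_sub_right] at h2
  rw [inner_add_left]
  have h3 : ‖d‖ * ‖x - z‖ ≤ μ / 2 * ‖x - z‖ ^ 2 + ‖d‖ ^ 2 * (1 / (2 * μ)) := by
    have : μ / 2 * ‖x - z‖ ^ 2 + ‖d‖ ^ 2 * (1 / (2 * μ)) - ‖d‖ * ‖x - z‖
      = (μ * ‖x - z‖ - ‖d‖) ^ 2 / (2 * μ) := by field_simp; ring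
    have h : 0 ≤ (μ * ‖x - z‖ - ‖d‖) ^ 2 / (2 * μ) := by positivity
    linarith
  linarith

lemma aux_lower {n : ℕ} (μ : ℝ) (hμ : 0 < μ)
    (f : EuclideanSpace ℝ (Fin n) → ℝ)
    (hf : ∀ x y : EuclideanSpace ℝ (Fin n), ∀ θ : ℝ, 0 ≤ θ → θ ≤ 1 →
      f (θ • x + (1 - θ) • y)
        ≤ θ * f x + (1 - θ) * f y - μ / 2 * θ * (1 - θ) * ‖x - y‖ ^ 2)
    (s z : EuclideanSpace ℝ (Fin n)) (hz : ∀ x, f z - ⟪s, z⟫ ≤ f x - ⟪s, x⟫)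
    (d : EuclideanSpace ℝ (Fin n)) :
    fenchelConj f s + ⟪d, z⟫ ≤ fenchelConj f (s + d) := by
  obtain ⟨w, hw⟩ := aux_ex μ hμ f hf (s + d)
  rw [aux_conj f s z hz, aux_conj f _ w hw]
  have := hw z
  rw [inner_add_left _ _ z] at this
  linarith

lemma aux_grad {n : ℕ} (μ : ℝ) (hμ : 0 < μ)
    (f : EuclideanSpace ℝ (Fin n) → ℝ)
    (hf : ∀ x y : EuclideanSpace ℝ (Fin n), ∀ θ : ℝ, 0 ≤ θ → θ ≤ 1 →
      f (θ • x + (1 - θ) • y)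
        ≤ θ * f x + (1 - θ) * f y - μ / 2 * θ * (1 - θ) * ‖x - y‖ ^ 2)
    (s z : EuclideanSpace ℝ (Fin n)) (hz : ∀ x, f z - ⟪s, z⟫ ≤ f x - ⟪s, x⟫) :
    gradient (fenchelConj f) s = z := by
  apply HasGradientAt.gradient
  rw [hasGradientAt_iff_isLittleO_nhds_zero]
  refine Asymptotics.IsBigO.trans_isLittleO (g := fun h => ‖h‖ ^ 2) ?_ ?_
  · refine Asymptotics.IsBigO.of_bound (1 / (2 * μ)) (Filter.Eventually.of_forall fun d => ?_)
    have h1 := aux_upper μ hμ f hf s z hz d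
    have h2 := aux_lower μ hμ f hf s z hz d
    rw [real_inner_comm, Real.norm_eq_abs, Real.norm_eq_abs, abs_of_nonneg (sq_nonneg ‖d‖), abs_le]
    have : 0 ≤ 1 / (2 * μ) * ‖d‖ ^ 2 := by positivity
    constructor <;> linarith
  · exact Asymptotics.isLittleO_norm_pow_id one_lt_two

/-- Convergence of the primal iterates: under Slater's condition,
with `x_opt` the (unique) primal optimal solution, a dual optimal `y_opt` with
`⟨e,y_opt⟩ ≤ c_D`, and any sequence `y_k ∈ K*` with `⟨e,y_k⟩ ≤ c_D` and
`h(y_k) → d* (= h(y_opt))`, the primal iterates `x_k = ∇f*(T* y_k)` converge to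
`x_opt`. -/
theorem stmt_16 {n m : ℕ} (μ : ℝ) (hμ : 0 < μ)
    (f : EuclideanSpace ℝ (Fin n) → ℝ)
    (hf : ∀ x y : EuclideanSpace ℝ (Fin n), ∀ θ : ℝ, 0 ≤ θ → θ ≤ 1 →
      f (θ • x + (1 - θ) • y)
        ≤ θ * f x + (1 - θ) * f y - μ / 2 * θ * (1 - θ) * ‖x - y‖ ^ 2)
    (T : EuclideanSpace ℝ (Fin n) →L[ℝ] EuclideanSpace ℝ (Fin m))
    (b : EuclideanSpace ℝ (Fin m)) (K : Set (EuclideanSpace ℝ (Fin m)))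
    (hclosed : IsClosed K) (hconv : Convex ℝ K)
    (hcone : ∀ (c : ℝ), 0 ≤ c → ∀ x ∈ K, c • x ∈ K)
    (hpointed : K ∩ (-K) = {0}) (hfull : (interior K).Nonempty)
    (hslater : ∃ xbar : EuclideanSpace ℝ (Fin n), T xbar + b ∈ interior K)
    (xopt : EuclideanSpace ℝ (Fin n))
    (hxfeas : T xopt + b ∈ K)
    (hxmin : ∀ x : EuclideanSpace ℝ (Fin n), T x + b ∈ K → f xopt ≤ f x)
    (e : EuclideanSpace ℝ (Fin m)) (he : e ∈ interior K)
    (cD : ℝ) (hcD : 0 < cD)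
    (yopt : EuclideanSpace ℝ (Fin m))
    (hyoptK : ∀ x ∈ K, 0 ≤ ⟪x, yopt⟫)
    (hyoptmin : ∀ y : EuclideanSpace ℝ (Fin m), (∀ x ∈ K, 0 ≤ ⟪x, y⟫) →
      dualObj f T b yopt ≤ dualObj f T b y)
    (hyoptcd : ⟪e, yopt⟫ ≤ cD)
    (y : ℕ → EuclideanSpace ℝ (Fin m))
    (hyK : ∀ k, (∀ x ∈ K, 0 ≤ ⟪x, y k⟫) ∧ ⟪e, y k⟫ ≤ cD)
    (hconvge : Filter.Tendsto (fun k => dualObj f T b (y k)) Filter.atTop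
      (nhds (dualObj f T b yopt))) :
    Filter.Tendsto
      (fun k => gradient (fenchelConj f) (ContinuousLinearMap.adjoint T (y k)))
      Filter.atTop (nhds xopt) := by
  have key : ∀ k, μ / 2 * ‖gradient (fenchelConj f) (ContinuousLinearMap.adjoint T (y k)) - xopt‖ ^ 2
      ≤ f xopt + dualObj f T b (y k) := by
    intro k
    obtain ⟨z, hz⟩ := aux_ex μ hμ f hf (ContinuousLinearMap.adjoint T (y k))
    rw [aux_grad μ hμ f hf _ z hz]
    have h1 := aux_strong μ f hf _ z hz xopt
    have h2 := (hyK k).1 _ hxfeas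
    unfold dualObj
    rw [aux_conj f _ z hz]
    rw [ContinuousLinearMap.adjoint_inner_left _ xopt] at h1
    rw [inner_add_left, real_inner_comm] at h2
    rw [norm_sub_rev]
    linarith
  have hdual : f xopt + dualObj f T b yopt ≤ 0 := by
    obtain ⟨z, hz⟩ := aux_ex μ hμ f hf (ContinuousLinearMap.adjoint T yopt)
    have hvar : ∀ v : EuclideanSpace ℝ (Fin m),
        (∀ t : ℝ, 0 < t → t ≤ 1 → ∀ x ∈ K, 0 ≤ ⟪x, yopt + t • v⟫) → 0 ≤ ⟪T z + b, v⟫ := by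
      intro v hv
      apply aux_quad _ (‖ContinuousLinearMap.adjoint T v‖ ^ 2 * (1 / (2 * μ)))
      intro t h0 h1
      have h2 := hyoptmin _ (hv t h0 h1)
      unfold dualObj at h2
      have h3 := aux_upper μ hμ f hf _ z hz (t • ContinuousLinearMap.adjoint T v)
      rw [map_add, map_smul, inner_add_right, inner_smul_right] at h2
      rw [inner_smul_left, ContinuousLinearMap.adjoint_inner_left, norm_smul, mul_pow,
        Real.norm_eq_abs, sq_abs] at h3
      rw [inner_add_left, real_inner_comm]
      simp only [conj_trivial] at h3
      linarith
    have hcs : 0 ≤ ⟪T z + b, -yopt⟫ := by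
      apply hvar
      intro t h0 h1 x hx
      have h2 := hyoptK x hx
      rw [inner_add_right, inner_smul_right, inner_neg_right]
      nlinarith
    have hfeas : T z + b ∈ K := by
      by_contra hn
      obtain ⟨g, u, hg1, hg2⟩ := geometric_hahn_banach_closed_point hconv hclosed hn
      obtain ⟨w, hw⟩ : ∃ w : EuclideanSpace ℝ (Fin m), ∀ x, g x = ⟪w, x⟫ :=
        ⟨(InnerProductSpace.toDual ℝ _).symm g, fun x => by simp⟩
      have hK0 : (0 : EuclideanSpace ℝ (Fin m)) ∈ K := by
        simpa using hcone 0 le_rfl _ hxfeas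
      have hu : 0 < u := by simpa using hg1 0 hK0
      have hneg : ∀ x ∈ K, g x ≤ 0 := by
        intro x hx
        by_contra hp
        push Not at hp
        have := hg1 _ (hcone (u / g x) (by positivity) x hx)
        rw [map_smul, smul_eq_mul, div_mul_cancel₀ _ hp.ne'] at this
        exact lt_irrefl _ this
      have := hvar (-w) (by
        intro t h0 h1 x hx
        have h2 := hyoptK x hx
        have h3 := hneg x hx
        rw [hw, real_inner_comm] at h3
        rw [inner_add_right, inner_smul_right, inner_neg_right]
        nlinarith)
      rw [inner_neg_right, real_inner_comm, ← hw] at this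
      linarith
    have h1 := hxmin z hfeas
    unfold dualObj
    rw [aux_conj f _ z hz, ContinuousLinearMap.adjoint_inner_left]
    rw [inner_neg_right, inner_add_left, real_inner_comm] at hcs
    linarith
  rw [tendsto_iff_norm_sub_tendsto_zero]
  have hlim : Filter.Tendsto
      (fun k => Real.sqrt (2 / μ * (dualObj f T b (y k) - dualObj f T b yopt)))
      Filter.atTop (nhds 0) := by
    have h := ((hconvge.sub_const (dualObj f T b yopt)).const_mul (2 / μ)).sqrt
    simpa using h
  refine squeeze_zero (fun _ => norm_nonneg _) (fun k => ?_) hlim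
  apply Real.le_sqrt_of_sq_le
  have h1 := key k
  rw [div_mul_eq_mul_div, le_div_iff₀ hμ]
  linarith
end
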